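/- There exists a constant C > 0 such that for every integral binary quartic form f with |Disc(f)| ≥ C, the number of pairs (x,y) ∈ ℤ² with |f(x,y)| = 1, counted up to the identification (x,y) ∼ (−x,−y), is at most 26. -/

import Mathlib

/-- Evaluation of the binary quartic form with coefficients `a, b, c, d, e` at `(x, y)`. -/
def quarticEval (a b c d e x y : ℤ) : ℤ :=
  a * x ^ 4 + b * x ^ 3 * y + c * x ^ 2 * y ^ 2 + d * x * y ^ 3 + e * y ^ 4

/-- The discriminant of the integral binary quartic form `ax⁴ + bx³y + cx²y² + dxy³ + ey⁴`. -/
def quarticDisc (a b c d e : ℤ) : ℤ :=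
  256 * a ^ 3 * e ^ 3 - 192 * a ^ 2 * b * d * e ^ 2 - 128 * a ^ 2 * c ^ 2 * e ^ 2
    + 144 * a ^ 2 * c * d ^ 2 * e - 27 * a ^ 2 * d ^ 4 + 144 * a * b ^ 2 * c * e ^ 2
    - 6 * a * b ^ 2 * d ^ 2 * e - 80 * a * b * c ^ 2 * d * e + 18 * a * b * c * d ^ 3
    + 16 * a * c ^ 4 * e - 4 * a * c ^ 3 * d ^ 2 - 27 * b ^ 4 * e ^ 2
    + 18 * b ^ 3 * c * d * e - 4 * b ^ 3 * d ^ 3 - 4 * b ^ 2 * c ^ 3 * e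
    + b ^ 2 * c ^ 2 * d ^ 2

open Polynomial

theorem hasseDeriv_aeval_eq_sum {S : Type*} [CommRing S] (f : ℤ[X]) {n : ℕ} (hn : f.natDegree < n)
    (k : ℕ) (r : S) : aeval r (hasseDeriv k f) =
      ∑ j ∈ Finset.range n, ((f.coeff j : ℤ) : S) * (j.choose k : S) * r ^ (j - k) := by
  rw [hasseDeriv_apply, Polynomial.sum_over_range' _ _ _ hn, map_sum]
  · refine Finset.sum_congr rfl fun j _ => ?_
    rw [aeval_monomial]
    simp
    ring
  · simp

theorem norm_aeval_hasseDeriv_le (f : ℤ[X]) {n : ℕ} (hn : f.natDegree < n) {X : ℝ} (hX : 0 ≤ X)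
    (hf : ∀ j, |(f.coeff j : ℝ)| ≤ X) (k : ℕ) (r : ℂ) :
    ‖aeval r (hasseDeriv k f)‖ ≤ X * 2 ^ n * max 1 ‖r‖ ^ (n - 1 - k) := by
  rw [hasseDeriv_aeval_eq_sum f hn]
  have h1 : (1 : ℝ) ≤ max 1 ‖r‖ := le_max_left _ _
  have hterm : ∀ j ∈ Finset.range n, ‖((f.coeff j : ℤ) : ℂ) * (j.choose k : ℂ) * r ^ (j - k)‖ ≤
      X * max 1 ‖r‖ ^ (n - 1 - k) * 2 ^ j := by
    intro j hj
    rw [Finset.mem_range] at hj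
    rw [norm_mul, norm_mul, norm_pow, Complex.norm_intCast, Complex.norm_natCast]
    have h2 : (j.choose k : ℝ) ≤ 2 ^ j := by exact_mod_cast Nat.choose_le_two_pow j k
    have h3 : ‖r‖ ^ (j - k) ≤ max 1 ‖r‖ ^ (n - 1 - k) :=
      (pow_le_pow_left₀ (norm_nonneg _) (le_max_right _ _) _).trans
        (pow_le_pow_right₀ h1 (by omega))
    calc _ ≤ X * 2 ^ j * max 1 ‖r‖ ^ (n - 1 - k) := by
          gcongr
          exact hf j
      _ = _ := by ring
  refine (norm_sum_le_of_le _ hterm).trans ?_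
  rw [← Finset.mul_sum]
  have h4 : ∑ j ∈ Finset.range n, (2 : ℝ) ^ j ≤ 2 ^ n := by
    have := geom_sum_eq (x := (2 : ℝ)) (by norm_num) n
    rw [this]; norm_num
  calc _ ≤ X * max 1 ‖r‖ ^ (n - 1 - k) * 2 ^ n := by gcongr
    _ = _ := by ring

/-- The integral polynomial whose value at `α` is the `k`-th Taylor coefficient at `α` of
`A - α B`. -/
noncomputable def diffForm (A B : ℤ[X]) (k : ℕ) : ℤ[X] :=
  hasseDeriv k A - X * hasseDeriv k B

theorem aeval_diffForm (A B : ℤ[X]) (k : ℕ) (α : ℂ) : aeval α (diffForm A B k) =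
    (taylor α (A.map (Int.castRingHom ℂ) - C α * B.map (Int.castRingHom ℂ))).coeff k := by
  have h : ∀ f : ℤ[X], aeval α (hasseDeriv k f) =
      (hasseDeriv k (f.map (Int.castRingHom ℂ))).eval α := by
    intro f
    have := hasseDeriv_aeval_eq_sum f (Nat.lt_succ_self _) k α
    rw [this, hasseDeriv_apply, Polynomial.sum_over_range' _ _ (f.natDegree + 1)
      (Nat.lt_succ_of_le natDegree_map_le), eval_finsetSum]
    · refine Finset.sum_congr rfl fun j _ => ?_
      simp only [coeff_map, eq_intCast, eval_monomial]
      ring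
    · simp
  rw [diffForm, map_sub, map_mul, aeval_X, h, h, taylor_coeff, map_sub, ← smul_eq_C_mul, map_smul]
  simp

theorem norm_aeval_diffForm_le (A B : ℤ[X]) {n : ℕ} (hA : A.natDegree < n) (hB : B.natDegree < n)
    {X : ℝ} (hX : 0 ≤ X) (hA' : ∀ j, |(A.coeff j : ℝ)| ≤ X) (hB' : ∀ j, |(B.coeff j : ℝ)| ≤ X)
    (k : ℕ) (α : ℂ) :
    ‖aeval α (diffForm A B k)‖ ≤ 2 * (X * 2 ^ n) * max 1 ‖α‖ ^ (n - 1 - k + 1) := by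
  rw [diffForm, map_sub, map_mul, aeval_X]
  have h1 := norm_aeval_hasseDeriv_le A hA hX hA' k α
  have h2 := norm_aeval_hasseDeriv_le B hB hX hB' k α
  have h3 : (1 : ℝ) ≤ max 1 ‖α‖ := le_max_left _ _
  have h4 : ‖α‖ ≤ max 1 ‖α‖ := le_max_right _ _
  refine (norm_sub_le _ _).trans ?_
  rw [norm_mul]
  have h5 : X * 2 ^ n * max 1 ‖α‖ ^ (n - 1 - k) ≤ X * 2 ^ n * max 1 ‖α‖ ^ (n - 1 - k + 1) := by
    have h7 := pow_le_pow_right₀ h3 (Nat.le_succ (n - 1 - k))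
    gcongr
  have h6 : ‖α‖ * ‖aeval α (hasseDeriv k B)‖ ≤
      max 1 ‖α‖ * (X * 2 ^ n * max 1 ‖α‖ ^ (n - 1 - k)) := by gcongr
  calc _ ≤ X * 2 ^ n * max 1 ‖α‖ ^ (n - 1 - k + 1) +
        max 1 ‖α‖ * (X * 2 ^ n * max 1 ‖α‖ ^ (n - 1 - k)) := by linarith
    _ = _ := by ring

/-- The product of an integral polynomial over the roots of a monic integral polynomial is an
integer. -/
theorem exists_int_eq_prod_aeval {F : ℤ[X]} (hF : F.Monic) {α : Fin 4 → ℂ}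
    (hα : F.map (Int.castRingHom ℂ) = ∏ i, (X - C (α i))) (T : ℤ[X]) :
    ∃ z : ℤ, (z : ℂ) = ∏ i, aeval (α i) T := by
  refine ⟨F.resultant T, ?_⟩
  have hm : (F.map (Int.castRingHom ℂ)).Monic := hF.map _
  have h1 := resultant_eq_prod_eval (F.map (Int.castRingHom ℂ)) (T.map (Int.castRingHom ℂ))
    T.natDegree natDegree_map_le (IsAlgClosed.splits _)
  rw [hm.leadingCoeff, one_pow, one_mul, hF.natDegree_map] at h1
  have h2 : ((F.resultant T : ℤ) : ℂ) =
      (F.map (Int.castRingHom ℂ)).resultant (T.map (Int.castRingHom ℂ)) F.natDegree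
        T.natDegree := by
    rw [resultant_map_map]; rfl
  have h3 : (F.map (Int.castRingHom ℂ)).roots = Finset.univ.val.map α := by
    rw [hα, ← roots_multiset_prod_X_sub_C (Finset.univ.val.map α), Multiset.map_map]
    rfl
  rw [h2, h1, h3, Multiset.map_map, ← Finset.prod_map_val]
  congr 1
  refine Multiset.map_congr rfl fun i _ => ?_
  rw [Function.comp_apply, eval_map, aeval_def]
  rfl

theorem exists_ne_close {V ι : Type*} [Fintype V] [Fintype ι] [DecidableEq ι] (Φ : V → ι → ℝ) (R : ι → ℝ)
    (hR : ∀ i, 0 < R i) (hΦ : ∀ v i, |Φ v i| ≤ R i) {N : ℕ} (hN : 0 < N)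
    (hcard : (N + 1) ^ Fintype.card ι < Fintype.card V) :
    ∃ v w, v ≠ w ∧ ∀ i, |Φ v i - Φ w i| * N < 2 * R i := by
  have hN' : (0 : ℝ) < N := by exact_mod_cast hN
  have hnn : ∀ v i, 0 ≤ (Φ v i + R i) * N / (2 * R i) := by
    intro v i
    have := neg_le_of_abs_le (hΦ v i)
    have := hR i
    apply div_nonneg _ (by positivity)
    apply mul_nonneg _ hN'.le
    linarith
  have hlt : ∀ v i, ⌊(Φ v i + R i) * N / (2 * R i)⌋₊ < N + 1 := by
    intro v i
    rw [Nat.lt_succ_iff]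
    apply Nat.floor_le_of_le
    have := le_of_abs_le (hΦ v i)
    have h2 := hR i
    rw [div_le_iff₀ (by positivity)]
    nlinarith
  obtain ⟨v, w, hvw, h⟩ := Fintype.exists_ne_map_eq_of_card_lt
    (fun (v : V) (i : ι) => (⟨_, hlt v i⟩ : Fin (N + 1))) (by simpa using hcard)
  refine ⟨v, w, hvw, fun i => ?_⟩
  have h1 := congrArg Fin.val (congrFun h i)
  simp only at h1
  have h2 := Nat.floor_le (hnn v i)
  have h3 := Nat.lt_floor_add_one ((Φ v i + R i) * N / (2 * R i))
  have h4 := Nat.floor_le (hnn w i)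
  have h5 := Nat.lt_floor_add_one ((Φ w i + R i) * N / (2 * R i))
  rw [h1] at h2 h3
  have hRi := hR i
  have h6 : |(Φ v i + R i) * N / (2 * R i) - (Φ w i + R i) * N / (2 * R i)| < 1 := by
    rw [abs_lt]; constructor <;> linarith
  have h7 : (Φ v i + R i) * N / (2 * R i) - (Φ w i + R i) * N / (2 * R i) =
      (Φ v i - Φ w i) * N / (2 * R i) := by ring
  rwa [h7, abs_div, abs_mul, abs_of_pos hN', abs_of_pos (by positivity : 0 < 2 * R i),
    div_lt_one (by positivity)] at h6

theorem exists_root_eq_conj {F : ℤ[X]} {α : Fin 4 → ℂ}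
    (hα : F.map (Int.castRingHom ℂ) = ∏ i, (X - C (α i))) (i : Fin 4) :
    ∃ j, α j = (starRingEnd ℂ) (α i) := by
  have h : ∀ z : ℂ, aeval z F = ∏ j, (z - α j) := by
    intro z
    have : aeval z F = (F.map (Int.castRingHom ℂ)).eval z := by rw [eval_map, aeval_def]; rfl
    rw [this, hα, eval_prod]; simp
  have h1 : aeval ((starRingEnd ℂ) (α i)) F = 0 := by
    have h2 : aeval (α i) F = 0 := by
      rw [h]; exact Finset.prod_eq_zero (Finset.mem_univ i) (sub_self _)
    rw [aeval_eq_sum_range] at h2 ⊢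
    simpa using congrArg (starRingEnd ℂ) h2
  rw [h, Finset.prod_eq_zero_iff] at h1
  obtain ⟨j, -, hj⟩ := h1
  exact ⟨j, (sub_eq_zero.1 hj).symm⟩

theorem aeval_conj_int (T : ℤ[X]) (z : ℂ) :
    aeval ((starRingEnd ℂ) z) T = (starRingEnd ℂ) (aeval z T) := by
  simp [aeval_eq_sum_range]

theorem diffForm_sub (A B A' B' : ℤ[X]) (k : ℕ) :
    diffForm (A - A') (B - B') k = diffForm A B k - diffForm A' B' k := by
  simp only [diffForm, map_sub]; ring

theorem coeff_ofFn_mem_Icc {n Y : ℕ} (v : Fin n → Fin (Y + 1)) (j : ℕ) :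
    0 ≤ (ofFn n fun j => ((v j : ℕ) : ℤ)).coeff j ∧
      (ofFn n fun j => ((v j : ℕ) : ℤ)).coeff j ≤ Y := by
  by_cases h : j < n
  · rw [ofFn_coeff_eq_val_of_lt _ h]
    exact ⟨by positivity, by exact_mod_cast Nat.lt_succ_iff.1 (v ⟨j, h⟩).2⟩
  · rw [ofFn_coeff_eq_zero_of_ge _ (not_lt.1 h)]; simp

/-- Siegel's lemma for simultaneous approximations `A / B` to the conjugates `α i`. -/
theorem exists_auxiliary_pair {F : ℤ[X]} (hF : F.Monic) {α : Fin 4 → ℂ}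
    (hα : F.map (Int.castRingHom ℂ) = ∏ i, (X - C (α i)))
    (hirr : ∀ T : ℤ[X], ∀ i, aeval (α i) T = 0 → ∀ j, aeval (α j) T = 0)
    {M : ℝ} (hM : M = ∏ i, max 1 ‖α i‖) {m n w Y : ℕ} (hn : n = 2 * m + w) (hw : 0 < w)
    (hY : 2 ^ (4 * m * (n + 4)) * M ^ (m * n) ≤ (Y : ℝ) ^ (2 * w)) :
    ∃ A B : ℤ[X], (A ≠ 0 ∨ B ≠ 0) ∧ A.natDegree < n ∧ B.natDegree < n ∧
      (∀ j, |A.coeff j| ≤ Y) ∧ (∀ j, |B.coeff j| ≤ Y) ∧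
      ∀ k < m, ∀ i, aeval (α i) (diffForm A B k) = 0 := by
  have hn1 : 1 ≤ n := by omega
  have hμ : ∀ i, (1 : ℝ) ≤ max 1 ‖α i‖ := fun i => le_max_left _ _
  have hM1 : 1 ≤ M := by
    rw [hM]; exact Finset.one_le_prod fun i _ => hμ i
  have hY1 : 1 ≤ Y := by
    rcases Nat.eq_zero_or_pos Y with h | h
    · rw [h, Nat.cast_zero, zero_pow (by omega)] at hY
      have : (0 : ℝ) < 2 ^ (4 * m * (n + 4)) * M ^ (m * n) := by positivity
      linarith
    · exact h
  have hY1' : (1 : ℝ) ≤ Y := by exact_mod_cast hY1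
  obtain ⟨K, hK1, hK⟩ : ∃ K : ℝ, 1 ≤ K ∧ K ^ 4 = M :=
    ⟨√√M, by rw [Real.one_le_sqrt, Real.one_le_sqrt]; exact hM1, by
      rw [show 4 = 2 * 2 from rfl, pow_mul, Real.sq_sqrt (Real.sqrt_nonneg _),
        Real.sq_sqrt (by linarith)]⟩
  set N := ⌈8 * (Y : ℝ) * 2 ^ n * K ^ n⌉₊ with hN
  have hNge : 8 * (Y : ℝ) * 2 ^ n * K ^ n ≤ N := Nat.le_ceil _
  have hKn : (1 : ℝ) ≤ K ^ n := one_le_pow₀ hK1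
  have h2n : (1 : ℝ) ≤ 2 ^ n := one_le_pow₀ (by norm_num)
  have hbig : (1 : ℝ) ≤ Y * 2 ^ n * K ^ n :=
    one_le_mul_of_one_le_of_one_le (one_le_mul_of_one_le_of_one_le hY1' h2n) hKn
  have hNle : (N : ℝ) + 1 ≤ 2 ^ (n + 4) * Y * K ^ n := by
    have := Nat.ceil_lt_add_one (a := 8 * (Y : ℝ) * 2 ^ n * K ^ n) (by positivity)
    rw [pow_add]
    nlinarith
  have hNpos : 0 < N := by
    rw [hN, Nat.ceil_pos]; positivity
  have hcard : (N + 1) ^ (4 * m) < (Y + 1) ^ (2 * n) := by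
    have h1 : ((N : ℝ) + 1) ^ (4 * m) ≤ (Y : ℝ) ^ (2 * n) :=
      calc ((N : ℝ) + 1) ^ (4 * m) ≤ (2 ^ (n + 4) * Y * K ^ n) ^ (4 * m) := by gcongr
        _ = 2 ^ (4 * m * (n + 4)) * M ^ (m * n) * Y ^ (4 * m) := by
            have h2 : (2 : ℝ) ^ (4 * m * (n + 4)) = (2 ^ (n + 4)) ^ (4 * m) := by
              rw [← pow_mul, mul_comm]
            rw [← hK, h2]
            generalize (2 : ℝ) ^ (n + 4) = E
            ring
        _ ≤ (Y : ℝ) ^ (2 * w) * Y ^ (4 * m) := by gcongr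
        _ = (Y : ℝ) ^ (2 * n) := by rw [hn]; ring
    have h2 : (N + 1) ^ (4 * m) ≤ Y ^ (2 * n) := by exact_mod_cast h1
    exact h2.trans_lt (Nat.pow_lt_pow_left (Nat.lt_succ_self _) (by omega))
  let P : (Fin n → Fin (Y + 1)) → ℤ[X] := fun v => ofFn n fun j => ((v j : ℕ) : ℤ)
  let Λ : (Fin n → Fin (Y + 1)) × (Fin n → Fin (Y + 1)) → Fin 4 × Fin m → ℂ :=
    fun v i => aeval (α i.1) (diffForm (P v.1) (P v.2) i.2)
  have hPdeg : ∀ v, (P v).natDegree < n := fun v => ofFn_natDegree_lt hn1 _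
  have hPI : ∀ v j, 0 ≤ (P v).coeff j ∧ (P v).coeff j ≤ Y := coeff_ofFn_mem_Icc
  have hPc : ∀ v j, |((P v).coeff j : ℝ)| ≤ Y := by
    intro v j
    rw [abs_of_nonneg (by exact_mod_cast (hPI v j).1)]
    exact_mod_cast (hPI v j).2
  let R : Fin 4 × Fin m → ℝ := fun i => 2 * (Y * 2 ^ n) * max 1 ‖α i.1‖ ^ n
  have hΛ : ∀ v i, ‖Λ v i‖ ≤ R i := by
    intro v i
    refine (norm_aeval_diffForm_le _ _ (hPdeg _) (hPdeg _) (by positivity) (hPc _) (hPc _)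
      _ _).trans ?_
    have := pow_le_pow_right₀ (hμ i.1) (show n - 1 - (i.2 : ℕ) + 1 ≤ n by omega)
    simp only [R]
    gcongr
  obtain ⟨v, v', hne, hclose⟩ := exists_ne_close
    (fun v i => if 0 ≤ (α i.1).im then (Λ v i).re else (Λ v i).im) R
    (fun i => by have := hμ i.1; simp only [R]; positivity)
    (fun v i => by
      refine le_trans ?_ (hΛ v i)
      split_ifs
      · exact Complex.abs_re_le_norm _
      · exact Complex.abs_im_le_norm _) hNpos (by
      simpa [pow_mul, pow_two, mul_comm, ← pow_add, two_mul] using hcard)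
  have hPinj : ∀ u u', P u = P u' → u = u' := by
    intro u u' h
    funext j
    have := congrArg (fun f => f.coeff (j : ℕ)) h
    simp only [P] at this
    rw [ofFn_coeff_eq_val_of_lt _ j.2, ofFn_coeff_eq_val_of_lt _ j.2] at this
    exact Fin.ext (by exact_mod_cast this)
  have hcoeff : ∀ u u' j, |(P u - P u').coeff j| ≤ Y := by
    intro u u' j
    have h1 := hPI u j
    have h2 := hPI u' j
    rw [coeff_sub, abs_le]
    constructor <;> linarith
  refine ⟨P v.1 - P v'.1, P v.2 - P v'.2, ?_, (natDegree_sub_le _ _).trans_lt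
    (max_lt (hPdeg _) (hPdeg _)), (natDegree_sub_le _ _).trans_lt
    (max_lt (hPdeg _) (hPdeg _)), hcoeff _ _, hcoeff _ _, ?_⟩
  · by_contra! h
    exact hne (Prod.ext (hPinj _ _ (sub_eq_zero.1 h.1)) (hPinj _ _ (sub_eq_zero.1 h.2)))
  intro k hk
  set T := diffForm (P v.1 - P v'.1) (P v.2 - P v'.2) k with hT
  have hTΛ : ∀ i, aeval (α i) T = Λ v (i, ⟨k, hk⟩) - Λ v' (i, ⟨k, hk⟩) := by
    intro i
    rw [hT, diffForm_sub, map_sub]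
  have hN' : (0 : ℝ) < N := by exact_mod_cast hNpos
  have hsmall : ∀ i, ‖aeval (α i) T‖ * N < 4 * (2 * (Y * 2 ^ n) * max 1 ‖α i‖ ^ n) := by
    intro i
    have hi := hclose (i, ⟨k, hk⟩)
    obtain ⟨i', hi'⟩ := exists_root_eq_conj hα i
    have hi2 := hclose (i', ⟨k, hk⟩)
    have hconj : aeval (α i') T = (starRingEnd ℂ) (aeval (α i) T) := by rw [hi', aeval_conj_int]
    have hnorm : ‖α i'‖ = ‖α i‖ := by rw [hi', Complex.norm_conj]
    have him : (α i').im = - (α i).im := by rw [hi', Complex.conj_im]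
    simp only [R, hnorm] at hi hi2
    have hre : ∀ i, (Λ v (i, ⟨k, hk⟩)).re - (Λ v' (i, ⟨k, hk⟩)).re = (aeval (α i) T).re := by
      intro i; rw [hTΛ, Complex.sub_re]
    have himm : ∀ i, (Λ v (i, ⟨k, hk⟩)).im - (Λ v' (i, ⟨k, hk⟩)).im = (aeval (α i) T).im := by
      intro i; rw [hTΛ, Complex.sub_im]
    have hle := Complex.norm_le_abs_re_add_abs_im (aeval (α i) T)
    have hle' := mul_le_mul_of_nonneg_right hle hN'.le
    have hpos : 0 < 2 * (Y * 2 ^ n) * max 1 ‖α i‖ ^ n := by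
      have := hμ i
      positivity
    rcases lt_trichotomy (α i).im 0 with h | h | h
    · rw [if_neg (not_le.2 h), if_neg (not_le.2 h), himm] at hi
      have h' : 0 ≤ (α i').im := by rw [him]; linarith
      rw [if_pos h', if_pos h', hre, hconj, Complex.conj_re] at hi2
      linarith
    · rw [if_pos h.ge, if_pos h.ge, hre] at hi
      have h0 : (aeval (α i) T).im = 0 := by
        rw [← Complex.conj_eq_iff_im, ← aeval_conj_int, Complex.conj_eq_iff_im.2 h]
      rw [h0, abs_zero, add_zero] at hle'
      linarith
    · rw [if_pos h.le, if_pos h.le, hre] at hi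
      have h' : ¬ 0 ≤ (α i').im := by rw [him]; linarith
      rw [if_neg h', if_neg h', himm, hconj, Complex.conj_im, abs_neg] at hi2
      linarith
  have hprod : ‖∏ i, aeval (α i) T‖ < 1 := by
    have hnn : ∀ i, 0 ≤ ‖aeval (α i) T‖ * N := fun i => by positivity
    have h1 := mul_lt_mul'' (mul_lt_mul'' (mul_lt_mul'' (hsmall 0) (hsmall 1) (hnn _) (hnn _))
      (hsmall 2) (mul_nonneg (hnn _) (hnn _)) (hnn _)) (hsmall 3)
      (mul_nonneg (mul_nonneg (hnn _) (hnn _)) (hnn _)) (hnn _)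
    have h2 : (8 * (Y : ℝ) * 2 ^ n * K ^ n) ^ 4 ≤ (N : ℝ) ^ 4 := by gcongr
    have h3 : (K ^ n) ^ 4 = (max 1 ‖α 0‖ * max 1 ‖α 1‖ * max 1 ‖α 2‖ * max 1 ‖α 3‖) ^ n := by
      rw [← Fin.prod_univ_four (fun i => max 1 ‖α i‖), ← hM, ← hK]; ring
    rw [norm_prod, Fin.prod_univ_four]
    refine lt_of_mul_lt_mul_right ?_ (pow_nonneg hN'.le 4)
    rw [mul_pow _ (K ^ n), h3, mul_pow, mul_pow, mul_pow] at h2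
    rw [one_mul]
    refine lt_of_lt_of_le (lt_of_eq_of_lt ?_ h1) (le_of_eq_of_le ?_ h2)
    · ring
    · generalize (2 : ℝ) ^ n = E
      ring
  obtain ⟨z, hz⟩ := exists_int_eq_prod_aeval hF hα T
  rw [← hz, Complex.norm_intCast] at hprod
  have hz0 : z = 0 := by rw [← Int.abs_lt_one_iff]; exact_mod_cast hprod
  rw [hz0, Int.cast_zero, eq_comm, Finset.prod_eq_zero_iff] at hz
  obtain ⟨i, -, hi⟩ := hz
  exact hirr T i hi

theorem X_sub_C_pow_dvd_of_aeval_diffForm {A B : ℤ[X]} {m : ℕ} {α : ℂ}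
    (h : ∀ k < m, aeval α (diffForm A B k) = 0) :
    (X - C α) ^ m ∣ A.map (Int.castRingHom ℂ) - C α * B.map (Int.castRingHom ℂ) := by
  rw [X_sub_C_pow_dvd_iff, X_pow_dvd_iff]
  intro d hd
  rw [← h d hd, aeval_diffForm, taylor_apply]

/-- Nonvanishing of the Wronskian of an auxiliary pair. -/
theorem wronskian_ne_zero_of_diffForm {α : Fin 4 → ℂ} (hinj : Function.Injective α)
    {A B : ℤ[X]} (hAB : A ≠ 0 ∨ B ≠ 0) {m n : ℕ} (hn : n ≤ 3 * m) (hA : A.natDegree < n)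
    (hB : B.natDegree < n) (h : ∀ k < m, ∀ i, aeval (α i) (diffForm A B k) = 0) :
    wronskian A B ≠ 0 := by
  classical
  intro hW
  set φ := Int.castRingHom ℂ with hφ
  have hφi : Function.Injective φ := Int.cast_injective
  set a := A.map φ with ha
  set b := B.map φ with hb
  have hab : a ≠ 0 ∨ b ≠ 0 :=
    hAB.imp (Polynomial.map_ne_zero_iff hφi).2 (Polynomial.map_ne_zero_iff hφi).2
  have hW' : wronskian a b = 0 := by
    have := congrArg (Polynomial.map φ) hW
    simpa only [wronskian, ha, hb, derivative_map, Polynomial.map_sub, Polynomial.map_mul,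
      Polynomial.map_zero] using this
  set g := EuclideanDomain.gcd a b with hg
  have hg0 : g ≠ 0 := by
    intro h0
    rw [hg, EuclideanDomain.gcd_eq_zero_iff] at h0
    tauto
  obtain ⟨u, hu⟩ := EuclideanDomain.gcd_dvd_left a b
  obtain ⟨v, hv⟩ := EuclideanDomain.gcd_dvd_right a b
  rw [← hg] at hu hv
  have hcop : IsCoprime u v := by
    have h1 := EuclideanDomain.gcd_eq_gcd_ab a b
    refine ⟨EuclideanDomain.gcdA a b, EuclideanDomain.gcdB a b, ?_⟩
    apply mul_left_cancel₀ hg0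
    rw [← hg] at h1
    linear_combination -h1 - EuclideanDomain.gcdA a b * hu - EuclideanDomain.gcdB a b * hv
  have huv : wronskian u v = 0 := by
    have h1 : wronskian a b = g ^ 2 * wronskian u v := by
      rw [hu, hv]
      simp only [wronskian, derivative_mul]
      ring
    rw [h1] at hW'
    exact (mul_eq_zero.1 hW').resolve_left (pow_ne_zero _ hg0)
  obtain ⟨hu', hv'⟩ := hcop.wronskian_eq_zero_iff.1 huv
  have huC := eq_C_of_derivative_eq_zero hu'
  have hvC := eq_C_of_derivative_eq_zero hv'
  set s := u.coeff 0
  set t := v.coeff 0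
  have hst : s ≠ 0 ∨ t ≠ 0 := by
    by_contra! h0
    rw [huC, hvC, h0.1, h0.2] at hcop
    rw [C_0] at hcop
    exact not_isCoprime_zero_zero hcop
  obtain ⟨I, hI⟩ : ∃ I, I = Finset.univ.filter fun i => s - α i * t ≠ 0 := ⟨_, rfl⟩
  have hIc : 3 ≤ I.card := by
    have h1 : (Finset.univ.filter fun i => ¬ (s - α i * t ≠ 0)).card ≤ 1 := by
      rw [Finset.card_le_one]
      intro i hi j hj
      simp only [Finset.mem_filter, Finset.mem_univ, true_and, not_not] at hi hj
      apply hinj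
      have ht : t ≠ 0 := by
        rintro ht
        rw [ht, mul_zero, sub_zero] at hi
        tauto
      apply mul_right_cancel₀ ht
      linear_combination hj - hi
    have h2 := Finset.card_filter_add_card_filter_not (s := (Finset.univ : Finset (Fin 4)))
      (fun i => s - α i * t ≠ 0)
    rw [Finset.card_univ, Fintype.card_fin, ← hI] at h2
    omega
  have hdvd : ∏ i ∈ I, (X - C (α i)) ^ m ∣ g := by
    apply Finset.prod_dvd_of_coprime
    · intro i _ j _ hij
      exact (pairwise_coprime_X_sub_C hinj hij).pow
    · intro i hi
      rw [hI, Finset.mem_filter] at hi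
      have h1 := X_sub_C_pow_dvd_of_aeval_diffForm fun k hk => h k hk i
      have h2 : a - C (α i) * b = g * C (s - α i * t) := by
        rw [hu, hv, huC, hvC, C_sub, C_mul]; ring
      rw [← hφ, ← ha, ← hb, h2] at h1
      exact (IsUnit.dvd_mul_right (isUnit_C.2 hi.2.isUnit)).1 h1
  have hdeg := natDegree_le_of_dvd hdvd hg0
  rw [natDegree_prod_of_monic _ _ (fun i _ => (monic_X_sub_C _).pow _)] at hdeg
  simp only [natDegree_pow, natDegree_X_sub_C, mul_one, Finset.sum_const, smul_eq_mul] at hdeg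
  have hgn : g.natDegree < n := by
    rcases hab with h0 | h0
    · exact (natDegree_le_of_dvd ⟨u, hu⟩ h0).trans_lt (natDegree_map_le.trans_lt hA)
    · exact (natDegree_le_of_dvd ⟨v, hv⟩ h0).trans_lt (natDegree_map_le.trans_lt hB)
  have := Nat.mul_le_mul_right m hIc
  omega

theorem prime_linear {p q : ℤ} (h : IsCoprime p q) (hq : q ≠ 0) :
    Prime (C q * X - C p : ℤ[X]) := by
  rw [← irreducible_iff_prime, sub_eq_add_neg, ← C_neg]
  exact irreducible_C_mul_X_add_C hq (h.symm.neg_right).isRelPrime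

theorem linear_dvd_of_aeval_eq_zero {p q : ℤ} (h : IsCoprime p q) (hq : q ≠ 0) {U : ℤ[X]}
    (hU : aeval ((p : ℂ) / q) U = 0) : (C q * X - C p : ℤ[X]) ∣ U := by
  have hd : (C q * X - C p : ℤ[X]).natDegree = 1 := by
    rw [sub_eq_add_neg, ← C_neg]; exact natDegree_linear hq
  have hprim : (C q * X - C p : ℤ[X]).IsPrimitive :=
    (prime_linear h hq).irreducible.isPrimitive (by omega)
  rw [IsPrimitive.Int.dvd_iff_map_cast_dvd_map_cast _ _ hprim]
  have hq' : (q : ℚ) ≠ 0 := by exact_mod_cast hq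
  have h1 : aeval ((p : ℚ) / q) U = 0 := by
    have h2 : (algebraMap ℚ ℂ) ((p : ℚ) / q) = (p : ℂ) / q := by simp
    rw [← h2, aeval_algebraMap_apply] at hU
    exact (map_eq_zero _).1 hU
  have h3 : (C q * X - C p : ℤ[X]).map (Int.castRingHom ℚ) = C (q : ℚ) * (X - C ((p : ℚ) / q)) := by
    rw [mul_sub, ← C_mul, mul_div_cancel₀ _ hq']
    simp
  rw [h3]
  refine ((isUnit_C.2 hq'.isUnit).mul_left_dvd).2 (dvd_iff_isRoot.2 ?_)
  rw [IsRoot.def, eval_map, ← h1, aeval_def]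
  rfl

/-- Coefficients of the Wronskian of integral polynomials with bounded coefficients. -/
theorem abs_coeff_wronskian_le {A B : ℤ[X]} {n : ℕ} {Y : ℤ} (hA : A.natDegree < n)
    (hB : B.natDegree < n) (hA' : ∀ j, |A.coeff j| ≤ Y) (hB' : ∀ j, |B.coeff j| ≤ Y) (j : ℕ) :
    |(wronskian A B).coeff j| ≤ 4 * n ^ 2 * Y ^ 2 := by
  have hY : 0 ≤ Y := (abs_nonneg _).trans (hA' 0)
  have key : ∀ f g : ℤ[X], f.natDegree < n → g.natDegree < n → (∀ j, |f.coeff j| ≤ Y) →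
      (∀ j, |g.coeff j| ≤ Y) → |(f * derivative g).coeff j| ≤ 2 * n ^ 2 * Y ^ 2 := by
    intro f g hf hg hf' hg'
    have hd : ∀ i, |(derivative g).coeff i| ≤ Y * n := by
      intro i
      rw [coeff_derivative, abs_mul]
      rcases lt_or_ge (i + 1) n with h | h
      · have : |((i : ℤ) + 1)| ≤ n := by
          rw [abs_of_nonneg (by positivity)]; exact_mod_cast h.le
        exact mul_le_mul (hg' _) this (abs_nonneg _) hY
      · rw [coeff_eq_zero_of_natDegree_lt (by omega)]
        simpa using mul_nonneg hY (by positivity)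
    rcases lt_or_ge j (2 * n) with h | h
    · rw [coeff_mul]
      refine (Finset.abs_sum_le_sum_abs _ _).trans ((Finset.sum_le_card_nsmul _ _ (Y * (Y * n))
        fun x _ => ?_).trans ?_)
      · rw [abs_mul]
        exact mul_le_mul (hf' _) (hd _) (abs_nonneg _) hY
      · rw [Finset.Nat.card_antidiagonal, nsmul_eq_mul]
        have : ((j + 1 : ℕ) : ℤ) ≤ 2 * n := by exact_mod_cast h
        have h2 : 0 ≤ Y * (Y * n) := by positivity
        nlinarith
    · rw [coeff_eq_zero_of_natDegree_lt]
      · simp; positivity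
      · have h1 := natDegree_mul_le (p := f) (q := derivative g)
        have h2 := natDegree_derivative_le g
        omega
  have h1 := key A B hA hB hA' hB'
  have h2 := key B A hB hA hB' hA'
  rw [wronskian, coeff_sub, mul_comm (derivative A)]
  refine (abs_sub _ _).trans ?_
  linarith

theorem one_le_pow_mul_norm_aeval_div {U : ℤ[X]} {p q : ℤ} (hq : 0 < q)
    (hU : aeval ((p : ℂ) / q) U ≠ 0) :
    1 ≤ (q : ℝ) ^ U.natDegree * ‖aeval ((p : ℂ) / q) U‖ := by
  have h1 : aeval ((p : ℂ) / q) U = ((aeval ((p : ℝ) / q) U : ℝ) : ℂ) := by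
    have h2 : (algebraMap ℝ ℂ) ((p : ℝ) / q) = (p : ℂ) / q := by simp
    rw [← h2, aeval_algebraMap_apply]
    rfl
  have h3 : eval ((p : ℝ) / q) (U.map (algebraMap ℤ ℝ)) = aeval ((p : ℝ) / q) U := by
    rw [eval_map, aeval_def]
  have h4 : eval ((p : ℝ) / q) (U.map (algebraMap ℤ ℝ)) ≠ 0 := by
    rw [h3]
    intro h
    rw [h1, h] at hU
    simp at hU
  have := one_le_pow_mul_abs_eval_div hq h4
  rwa [h3, ← Real.norm_eq_abs, ← Complex.norm_real, ← h1] at this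

theorem norm_coeff_taylor_le {G : ℂ[X]} {n m l : ℕ} (hG : G.natDegree < n) {E δ : ℝ}
    (hE : ∀ j, m ≤ j → ‖G.coeff j‖ ≤ E) (h0 : ∀ j < m, G.coeff j = 0) {ε : ℂ}
    (hε : ‖ε‖ ≤ δ) (hδ : δ ≤ 1) (hlm : l ≤ m) :
    ‖(taylor ε G).coeff l‖ ≤ E * 2 ^ n * δ ^ (m - l) := by
  have hδ0 : 0 ≤ δ := (norm_nonneg _).trans hε
  have hE0 : 0 ≤ E := (norm_nonneg _).trans (hE m le_rfl)
  have hs : (taylor ε G).coeff l =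
      ∑ j ∈ Finset.range n, G.coeff j * (j.choose l : ℂ) * ε ^ (j - l) := by
    rw [taylor_coeff, hasseDeriv_apply, Polynomial.sum_over_range' _ _ _ hG, eval_finsetSum]
    · refine Finset.sum_congr rfl fun j _ => ?_
      simp only [eval_monomial]
      ring
    · simp
  have hterm : ∀ j ∈ Finset.range n, ‖G.coeff j * (j.choose l : ℂ) * ε ^ (j - l)‖ ≤
      E * δ ^ (m - l) * 2 ^ j := by
    intro j _
    rcases lt_or_ge j m with h | h
    · rw [h0 j h]; simp; positivity
    · rw [norm_mul, norm_mul, norm_pow, Complex.norm_natCast]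
      have h2 : (j.choose l : ℝ) ≤ 2 ^ j := by exact_mod_cast Nat.choose_le_two_pow j l
      have h3 : ‖ε‖ ^ (j - l) ≤ δ ^ (m - l) :=
        (pow_le_pow_left₀ (norm_nonneg _) hε _).trans
          (pow_le_pow_of_le_one hδ0 hδ (by omega))
      calc _ ≤ E * 2 ^ j * δ ^ (m - l) := by
            gcongr
            exact hE j h
        _ = _ := by ring
  rw [hs]
  refine (norm_sum_le_of_le _ hterm).trans ?_
  rw [← Finset.mul_sum]
  have h4 : ∑ j ∈ Finset.range n, (2 : ℝ) ^ j ≤ 2 ^ n := by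
    rw [geom_sum_eq (by norm_num) n]; norm_num
  calc _ ≤ E * δ ^ (m - l) * 2 ^ n := by gcongr
    _ = _ := by ring

/-- Upper bound for the Taylor coefficients of `q₂ A - p₂ B` at a rational number close to `α`. -/
theorem norm_coeff_taylor_auxiliary_le {A B : ℤ[X]} {m n l : ℕ} (hA : A.natDegree < n)
    (hB : B.natDegree < n) {Y : ℝ} (hA' : ∀ j, |(A.coeff j : ℝ)| ≤ Y)
    (hB' : ∀ j, |(B.coeff j : ℝ)| ≤ Y) {α : ℂ} (h : ∀ k < m, aeval α (diffForm A B k) = 0)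
    (hmn : m ≤ n) (hlm : l ≤ m) {x : ℂ} {δ M : ℝ} (hx : ‖x - α‖ ≤ δ) (hδ : δ ≤ 1)
    (hM : max 1 ‖α‖ ≤ M) (p q : ℤ) :
    ‖aeval x (hasseDeriv l (C q * A - C p * B))‖ ≤
      4 ^ n * Y * (2 * |(q : ℝ)| * δ ^ (m - l) * M ^ (n - m) + ‖(p : ℂ) - α * q‖ * M ^ (n - 1)) := by
  have hY : 0 ≤ Y := (abs_nonneg _).trans (hA' 0)
  have hM1 : 1 ≤ M := (le_max_left _ _).trans hM
  set φ := Int.castRingHom ℂ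
  set T := A.map φ - C α * B.map φ with hT
  have hTdeg : T.natDegree < n := by
    refine (natDegree_sub_le _ _).trans_lt (max_lt (natDegree_map_le.trans_lt hA) ?_)
    exact (natDegree_C_mul_le _ _).trans_lt (natDegree_map_le.trans_lt hB)
  have hT1 : ‖(taylor x T).coeff l‖ ≤ (2 * (Y * 2 ^ n) * M ^ (n - m)) * 2 ^ n * δ ^ (m - l) := by
    have : taylor x T = taylor (x - α) (taylor α T) := by rw [taylor_taylor, sub_add_cancel]
    rw [this]
    refine norm_coeff_taylor_le (by rwa [natDegree_taylor]) ?_ ?_ hx hδ hlm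
    · intro j hj
      rcases lt_or_ge j n with hjn | hjn
      · rw [hT, ← aeval_diffForm]
        refine (norm_aeval_diffForm_le A B hA hB hY hA' hB' j α).trans ?_
        have h1 : max 1 ‖α‖ ^ (n - 1 - j + 1) ≤ M ^ (n - m) :=
          (pow_le_pow_left₀ (by positivity) hM _).trans (pow_le_pow_right₀ hM1 (by omega))
        gcongr
      · rw [coeff_eq_zero_of_natDegree_lt (by rw [natDegree_taylor]; omega), norm_zero]
        positivity
    · intro j hj
      rw [hT, ← aeval_diffForm, h j hj]
  have hlin : aeval x (hasseDeriv l (C q * A - C p * B)) =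
      q * (taylor x T).coeff l - (p - α * q) * aeval x (hasseDeriv l B) := by
    have h1 : aeval x (hasseDeriv l A) = (taylor x T).coeff l + α * aeval x (hasseDeriv l B) := by
      have h2 : ∀ f : ℤ[X], aeval x (hasseDeriv l f) = (taylor x (f.map φ)).coeff l := by
        intro f
        have := aeval_diffForm f 0 l x
        simpa [diffForm] using this
      rw [h2, h2, hT, map_sub, ← smul_eq_C_mul, map_smul]
      simp
    rw [← smul_eq_C_mul, ← smul_eq_C_mul, map_sub, map_smul, map_smul, map_sub, map_zsmul,
      map_zsmul, h1, zsmul_eq_mul, zsmul_eq_mul]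
    ring
  have hB1 : ‖aeval x (hasseDeriv l B)‖ ≤ Y * 4 ^ n * M ^ (n - 1) := by
    refine (norm_aeval_hasseDeriv_le B hB hY hB' l x).trans ?_
    have h1 : max 1 ‖x‖ ≤ 2 * M := by
      have h2 : ‖x‖ ≤ ‖x - α‖ + ‖α‖ := norm_le_norm_sub_add x α
      have h3 := (le_max_right _ _).trans hM
      exact max_le (by linarith) (by linarith)
    have h4 : max 1 ‖x‖ ^ (n - 1 - l) ≤ 2 ^ n * M ^ (n - 1) := by
      calc _ ≤ (2 * M) ^ (n - 1 - l) := by gcongr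
        _ ≤ (2 * M) ^ (n - 1) := pow_le_pow_right₀ (by linarith) (by omega)
        _ = 2 ^ (n - 1) * M ^ (n - 1) := mul_pow _ _ _
        _ ≤ _ := by
          gcongr
          · norm_num
          · omega
    calc _ ≤ Y * 2 ^ n * (2 ^ n * M ^ (n - 1)) := by gcongr
      _ = Y * (2 * 2) ^ n * M ^ (n - 1) := by rw [mul_pow]; ring
      _ = _ := by norm_num
  rw [hlin]
  refine (norm_sub_le _ _).trans ?_
  rw [norm_mul, norm_mul, Complex.norm_intCast]
  have h4 : (4 : ℝ) ^ n = 2 ^ n * 2 ^ n := by rw [← mul_pow]; norm_num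
  calc _ ≤ |(q : ℝ)| * ((2 * (Y * 2 ^ n) * M ^ (n - m)) * 2 ^ n * δ ^ (m - l)) +
        ‖(p : ℂ) - α * q‖ * (Y * 4 ^ n * M ^ (n - 1)) := by gcongr
    _ = _ := by rw [h4]; ring

theorem max_one_le_prod {ι : Type*} [Fintype ι] (α : ι → ℂ) (i : ι) :
    max 1 ‖α i‖ ≤ ∏ j, max 1 ‖α j‖ := by
  classical
  rw [← Finset.mul_prod_erase _ _ (Finset.mem_univ i)]
  exact le_mul_of_one_le_right (by positivity)
    (Finset.one_le_prod fun j _ => le_max_left _ _)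

/-- The fundamental inequality of Thue's method for two good approximations `p₁ / q₁` and
`p₂ / q₂` to the same root. -/
theorem thue_inequality {F : ℤ[X]} (hF : F.Monic) {α : Fin 4 → ℂ}
    (hα : F.map (Int.castRingHom ℂ) = ∏ i, (X - C (α i))) (hinj : Function.Injective α)
    (hirr : ∀ T : ℤ[X], ∀ i, aeval (α i) T = 0 → ∀ j, aeval (α j) T = 0)
    {M : ℝ} (hM : M = ∏ i, max 1 ‖α i‖) {m n w Y : ℕ} (hn : n = 2 * m + w) (hw : 0 < w)
    (hwm : w ≤ m) (hY : 2 ^ (4 * m * (n + 4)) * M ^ (m * n) ≤ (Y : ℝ) ^ (2 * w))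
    (i : Fin 4) {p₁ q₁ p₂ q₂ : ℤ} (hcop : IsCoprime p₁ q₁) (hq₁ : 0 < q₁) (hq₂ : 0 < q₂)
    {δ : ℝ} (hδ : δ ≤ 1) (h₁ : ‖(p₁ : ℂ) / q₁ - α i‖ ≤ δ) :
    ∃ l : ℕ, (l = 0 ∨ (q₁ : ℝ) ^ (l - 1) ≤ 4 * n ^ 2 * Y ^ 2) ∧
      (l ≤ m → (q₁ : ℝ) ^ (2 * l) ≤ q₁ ^ (n - 1) * (4 ^ n * Y *
        (2 * q₂ * δ ^ (m - l) * M ^ (n - m) + ‖(p₂ : ℂ) - α i * q₂‖ * M ^ (n - 1)))) := by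
  obtain ⟨A, B, hAB, hA, hB, hA', hB', hform⟩ :=
    exists_auxiliary_pair hF hα hirr hM hn hw hY
  have hW := wronskian_ne_zero_of_diffForm hinj hAB (by omega) hA hB hform
  set P : ℤ[X] := C q₂ * A - C p₂ * B with hP
  have hq₂' : (C q₂ : ℤ[X]) ≠ 0 := C_ne_zero.2 hq₂.ne'
  have hPW : C q₂ * wronskian A B = wronskian P B := by
    simp only [wronskian, hP, derivative_sub, derivative_mul, derivative_C]
    ring
  have hP0 : P ≠ 0 := by
    intro h0
    rw [h0, wronskian_zero_left] at hPW
    exact (mul_ne_zero hq₂' hW) hPW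
  set L : ℤ[X] := C q₁ * X - C p₁ with hL
  have hLp : Prime L := prime_linear hcop hq₁.ne'
  have hLd : L.natDegree = 1 := by
    rw [hL, sub_eq_add_neg, ← C_neg]; exact natDegree_linear hq₁.ne'
  have hLl : L.leadingCoeff = q₁ := by
    rw [leadingCoeff, hLd, hL, coeff_sub, coeff_C_mul, coeff_X_one, coeff_C_succ, mul_one, sub_zero]
  obtain ⟨U, hU, hLU⟩ := (FiniteMultiplicity.of_not_isUnit hLp.not_isUnit hP0
    ).exists_eq_pow_mul_and_not_dvd
  set l := multiplicity L P
  have hU0 : U ≠ 0 := by rintro rfl; exact hLU (dvd_zero _)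
  have hUx : aeval ((p₁ : ℂ) / q₁) U ≠ 0 := fun h0 =>
    hLU (linear_dvd_of_aeval_eq_zero hcop hq₁.ne' h0)
  refine ⟨l, ?_, fun hlm => ?_⟩
  · rcases Nat.eq_zero_or_pos l with h0 | h0
    · exact Or.inl h0
    · right
      obtain ⟨t, ht⟩ : ∃ t, l = t + 1 := ⟨l - 1, by omega⟩
      rw [ht, Nat.add_sub_cancel]
      have hdvd : L ^ t ∣ C q₂ * wronskian A B := by
        rw [hPW, hU, ht]
        refine ⟨L * U * derivative B - (C ((t : ℤ) + 1) * derivative L * U + L * derivative U) * B,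
          ?_⟩
        simp only [wronskian, derivative_mul, derivative_pow, Nat.add_sub_cancel]
        push_cast
        simp only [map_add, map_one, map_natCast]
        ring
      have hLq : ¬ L ∣ C q₂ := by
        intro h
        have := natDegree_le_of_dvd h hq₂'
        rw [natDegree_C] at this
        omega
      obtain ⟨V, hV⟩ := hLp.pow_dvd_of_dvd_mul_left t hLq hdvd
      have hlc := congrArg leadingCoeff hV
      rw [leadingCoeff_mul, leadingCoeff_pow, hLl] at hlc
      have hlc0 : (wronskian A B).leadingCoeff ≠ 0 := leadingCoeff_ne_zero.2 hW
      have h1 : q₁ ^ t ≤ |(wronskian A B).leadingCoeff| :=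
        Int.le_of_dvd (abs_pos.2 hlc0) ((dvd_abs _ _).2 ⟨_, hlc⟩)
      have h2 := h1.trans (abs_coeff_wronskian_le hA hB hA' hB' _)
      exact_mod_cast h2
  · have hcast : ∀ f : ℤ[X], (∀ j, |f.coeff j| ≤ Y) → ∀ j, |(f.coeff j : ℝ)| ≤ (Y : ℝ) :=
      fun f hf j => by exact_mod_cast hf j
    have hMi : max 1 ‖α i‖ ≤ M := by
      rw [hM]
      exact max_one_le_prod α i
    have hup := norm_coeff_taylor_auxiliary_le hA hB (hcast A hA') (hcast B hB')
      (fun k hk => hform k hk i) (by omega) hlm h₁ hδ hMi p₂ q₂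
    rw [← hP, abs_of_pos (by exact_mod_cast hq₂ : (0 : ℝ) < q₂)] at hup
    have hq₁c : (q₁ : ℂ) ≠ 0 := by exact_mod_cast hq₁.ne'
    have hval : aeval ((p₁ : ℂ) / q₁) (hasseDeriv l P) =
        (q₁ : ℂ) ^ l * aeval ((p₁ : ℂ) / q₁) U := by
      have h2 : ∀ f : ℤ[X], aeval ((p₁ : ℂ) / q₁) (hasseDeriv l f) =
          (taylor ((p₁ : ℂ) / q₁) (f.map (Int.castRingHom ℂ))).coeff l := by
        intro f
        have := aeval_diffForm f 0 l ((p₁ : ℂ) / q₁)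
        simpa [diffForm] using this
      have h3 : taylor ((p₁ : ℂ) / q₁) (L.map (Int.castRingHom ℂ)) = C (q₁ : ℂ) * X := by
        have h4 : (C (p₁ : ℂ) : ℂ[X]) = C (q₁ : ℂ) * C ((p₁ : ℂ) / q₁) := by
          rw [← C_mul, mul_div_cancel₀ _ hq₁c]
        have h5 : L.map (Int.castRingHom ℂ) = C (q₁ : ℂ) * X - C (p₁ : ℂ) := by
          rw [hL, Polynomial.map_sub, Polynomial.map_mul, map_X, map_C, map_C]; rfl
        rw [h5, h4, taylor_apply, sub_comp, mul_comp, mul_comp, C_comp, C_comp, X_comp]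
        ring
      rw [h2, hU, Polynomial.map_mul, Polynomial.map_pow, taylor_mul, taylor_pow, h3, mul_pow,
        ← C_pow, mul_assoc, coeff_C_mul, coeff_X_pow_mul', if_pos le_rfl, Nat.sub_self,
        taylor_coeff_zero, eval_map, aeval_def]
      rfl
    have hlow := one_le_pow_mul_norm_aeval_div hq₁ hUx
    have hdeg : U.natDegree + l ≤ n - 1 := by
      have h1 : P.natDegree < n := (natDegree_sub_le _ _).trans_lt (max_lt
        ((natDegree_C_mul_le _ _).trans_lt hA) ((natDegree_C_mul_le _ _).trans_lt hB))
      rw [hU, natDegree_mul (pow_ne_zero _ hLp.ne_zero) hU0, natDegree_pow, hLd] at h1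
      omega
    rw [hval, norm_mul, norm_pow, Complex.norm_intCast,
      abs_of_pos (by exact_mod_cast hq₁ : (0 : ℝ) < q₁)] at hup
    have hq1 : (1 : ℝ) ≤ q₁ := by exact_mod_cast hq₁
    calc (q₁ : ℝ) ^ (2 * l) ≤ q₁ ^ (2 * l) * (q₁ ^ U.natDegree * ‖aeval ((p₁ : ℂ) / q₁) U‖) :=
          le_mul_of_one_le_right (by positivity) hlow
      _ = q₁ ^ (U.natDegree + l) * (q₁ ^ l * ‖aeval ((p₁ : ℂ) / q₁) U‖) := by ring
      _ ≤ q₁ ^ (n - 1) * (q₁ ^ l * ‖aeval ((p₁ : ℂ) / q₁) U‖) := by gcongr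
      _ ≤ _ := by gcongr

theorem exists_nat_pow_ge_and_log_le {E : ℝ} (hE : 0 ≤ E) {k : ℕ} (hk : 0 < k) :
    ∃ Y : ℕ, 1 ≤ Y ∧ Real.exp E ≤ (Y : ℝ) ^ k ∧ Real.log Y ≤ E / k + 1 := by
  have hk' : (0 : ℝ) < k := by exact_mod_cast hk
  have h0 : 1 ≤ Real.exp (E / k) := Real.one_le_exp (by positivity)
  have h1 : Real.exp (E / k) ≤ ⌈Real.exp (E / k)⌉₊ := Nat.le_ceil _
  have h2 : (1 : ℝ) ≤ ⌈Real.exp (E / k)⌉₊ := h0.trans h1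
  refine ⟨⌈Real.exp (E / k)⌉₊, by exact_mod_cast h2, ?_, ?_⟩
  · calc Real.exp E = Real.exp (E / k) ^ k := by
          rw [← Real.exp_nat_mul]; congr 1; field_simp
      _ ≤ _ := by gcongr
  · rw [Real.log_le_iff_le_exp (by linarith), Real.exp_add]
    have h3 := Nat.ceil_lt_add_one (Real.exp_pos (E / k)).le
    have h4 := Real.add_one_le_exp (1 : ℝ)
    nlinarith

/-- Logarithmic form of `thue_inequality`. -/
theorem thue_inequality_log {F : ℤ[X]} (hF : F.Monic) {α : Fin 4 → ℂ}
    (hα : F.map (Int.castRingHom ℂ) = ∏ i, (X - C (α i))) (hinj : Function.Injective α)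
    (hirr : ∀ T : ℤ[X], ∀ i, aeval (α i) T = 0 → ∀ j, aeval (α j) T = 0)
    {M : ℝ} (hM : M = ∏ i, max 1 ‖α i‖) (i : Fin 4) {p₁ q₁ p₂ q₂ : ℤ}
    (hcop : IsCoprime p₁ q₁) (hq₁ : 0 < q₁) (hq₂ : 0 < q₂) {Λ L₁ L₂ : ℝ} (hΛ : Λ = Real.log M)
    (hL₁ : L₁ = Real.log q₁) (hL₂ : L₂ = Real.log q₂)
    (h₁ : ‖(p₁ : ℂ) - α i * q₁‖ * q₁ ^ 3 ≤ 64 * M ^ 2)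
    (h₂ : ‖(p₂ : ℂ) - α i * q₂‖ * q₂ ^ 3 ≤ 64 * M ^ 2) (hbig : 5 + 2 * Λ ≤ 4 * L₁)
    {m n w : ℕ} (hn : n = 2 * m + w) (hw : 0 < w) (hwm : w ≤ m) (hmw : m ≤ 4 * w) :
    ∃ l : ℕ, (l = 0 ∨ ((l : ℝ) - 1) * L₁ ≤ m * n / w * Λ + 100 * n) ∧ (l ≤ m →
      2 * l * L₁ ≤ (n - 1) * L₁ + m * n / (2 * w) * Λ + 100 * n + L₂ + (m - l) * (2 * Λ - 4 * L₁)
        + (n - m) * Λ ∨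
      2 * l * L₁ ≤ (n - 1) * L₁ + m * n / (2 * w) * Λ + 100 * n + (n + 1) * Λ - 3 * L₂) := by
  have hM1 : 1 ≤ M := by
    rw [hM]; exact Finset.one_le_prod fun i _ => le_max_left _ _
  have hM0 : 0 < M := by linarith
  have hΛ0 : 0 ≤ Λ := hΛ ▸ Real.log_nonneg hM1
  have hw' : (0 : ℝ) < w := by exact_mod_cast hw
  have hmw' : (m : ℝ) ≤ 4 * w := by exact_mod_cast hmw
  have hn1 : (3 : ℝ) ≤ n := by exact_mod_cast (by omega : 3 ≤ n)
  have hmn : (m : ℝ) ≤ n := by exact_mod_cast (by omega : m ≤ n)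
  have hq₁' : (0 : ℝ) < q₁ := by exact_mod_cast hq₁
  have hq₂' : (0 : ℝ) < q₂ := by exact_mod_cast hq₂
  have hl2 : Real.log 2 < 0.7 := by have := Real.log_two_lt_d9; linarith
  have hl2' : 0 < Real.log 2 := Real.log_pos (by norm_num)
  have hl4 : Real.log 4 = 2 * Real.log 2 := by
    rw [show (4 : ℝ) = 2 ^ 2 by norm_num, Real.log_pow]; norm_num
  have hl64 : Real.log 64 = 6 * Real.log 2 := by
    rw [show (64 : ℝ) = 2 ^ 6 by norm_num, Real.log_pow]; norm_num
  obtain ⟨Y, hY1, hYp, hYl⟩ := exists_nat_pow_ge_and_log_le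
    (E := 4 * m * (n + 4) * Real.log 2 + m * n * Λ) (by positivity) (k := 2 * w) (by omega)
  have hY0 : (0 : ℝ) < Y := by exact_mod_cast hY1
  have hYp' : 2 ^ (4 * m * (n + 4)) * M ^ (m * n) ≤ (Y : ℝ) ^ (2 * w) := by
    refine le_of_eq_of_le ?_ hYp
    rw [Real.exp_add, hΛ]
    have e1 : (4 : ℝ) * m * (n + 4) = ((4 * m * (n + 4) : ℕ) : ℝ) := by push_cast; ring
    have e2 : (m : ℝ) * n = ((m * n : ℕ) : ℝ) := by push_cast; ring
    rw [e1, e2, Real.exp_nat_mul, Real.exp_nat_mul, Real.exp_log hM0, Real.exp_log (by norm_num)]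
  have hYl' : Real.log Y ≤ m * n / (2 * w) * Λ + 30 * n := by
    refine hYl.trans ?_
    have e1 : (4 * m * (n + 4) * Real.log 2 + m * n * Λ) / ((2 * w : ℕ) : ℝ) =
        2 * (m / w) * (n + 4) * Real.log 2 + m * n / (2 * w) * Λ := by
      push_cast; field_simp; ring
    have e2 : (m : ℝ) / w ≤ 4 := by rw [div_le_iff₀ hw']; exact hmw'
    have e3 : 2 * ((m : ℝ) / w) * (n + 4) * Real.log 2 ≤ 2 * 4 * (n + 4) * 0.7 := by gcongr
    rw [e1]
    linarith
  set δ : ℝ := 64 * M ^ 2 / q₁ ^ 4 with hδ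
  have hδ0 : 0 < δ := by positivity
  have hδl : Real.log δ ≤ 5 + 2 * Λ - 4 * L₁ := by
    rw [hδ, Real.log_div (by positivity) (by positivity), Real.log_mul (by norm_num) (by positivity),
      Real.log_pow, Real.log_pow, hl64, hΛ, hL₁]
    push_cast
    linarith
  have hδ1 : δ ≤ 1 := by
    rw [← Real.log_nonpos_iff hδ0.le]; linarith
  have hap : ‖(p₁ : ℂ) / q₁ - α i‖ ≤ δ := by
    have e1 : (p₁ : ℂ) / q₁ - α i = (p₁ - α i * q₁) / q₁ := by
      have : (q₁ : ℂ) ≠ 0 := by exact_mod_cast hq₁.ne'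
      field_simp
    rw [e1, norm_div, Complex.norm_intCast, abs_of_pos hq₁', hδ, div_le_div_iff₀ hq₁' (by positivity)]
    calc _ = (‖(p₁ : ℂ) - α i * q₁‖ * q₁ ^ 3) * q₁ := by ring
      _ ≤ _ := by gcongr
  obtain ⟨l, hl, hle⟩ := thue_inequality hF hα hinj hirr hM hn hw hwm hYp' i (p₂ := p₂) hcop hq₁ hq₂
    hδ1 hap
  refine ⟨l, ?_, fun hlm => ?_⟩
  · rcases hl with h | h
    · exact Or.inl h
    rcases Nat.eq_zero_or_pos l with h0 | h0
    · exact Or.inl h0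
    right
    have h3 := Real.log_le_log (by positivity) h
    rw [Real.log_pow, Real.log_mul (by positivity) (by positivity), Real.log_pow,
      Real.log_mul (by norm_num) (by positivity), Real.log_pow, hl4, ← hL₁, Nat.cast_sub h0] at h3
    have h4 : Real.log n ≤ n := (Real.log_le_sub_one_of_pos (by linarith)).trans (by linarith)
    push_cast at h3
    have e1 : (m : ℝ) * n / w * Λ = 2 * (m * n / (2 * w) * Λ) := by field_simp
    rw [e1]
    linarith
  · have hle := hle hlm
    have hlm' : (l : ℝ) ≤ m := by exact_mod_cast hlm
    have hm0 : (0 : ℝ) ≤ m := by positivity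
    have hlin : ‖(p₂ : ℂ) - α i * q₂‖ ≤ 64 * M ^ 2 / q₂ ^ 3 := by
      rwa [le_div_iff₀ (by positivity)]
    have e1 : ((m - l : ℕ) : ℝ) = m - l := by rw [Nat.cast_sub hlm]
    have e2 : ((n - 1 : ℕ) : ℝ) = n - 1 := by rw [Nat.cast_sub (by omega)]; simp
    have e3 : ((n - m : ℕ) : ℝ) = n - m := by rw [Nat.cast_sub (by omega)]
    have hδm : (m - l) * Real.log δ ≤ (m - l) * (2 * Λ - 4 * L₁) + 5 * n := by
      have h5 : (m - l) * Real.log δ ≤ (m - l) * (5 + 2 * Λ - 4 * L₁) :=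
        mul_le_mul_of_nonneg_left hδl (by linarith)
      have h6 : (0 : ℝ) ≤ l := by positivity
      linarith
    have key : ∀ a : ℝ, 0 < a → (q₁ : ℝ) ^ (2 * l) ≤ q₁ ^ (n - 1) * (4 ^ n * Y * (2 * a)) →
        2 * l * L₁ ≤ (n - 1) * L₁ + m * n / (2 * w) * Λ + 40 * n + Real.log a := by
      intro a ha h
      have h3 := Real.log_le_log (by positivity) h
      rw [Real.log_pow, Real.log_mul (by positivity) (by positivity), Real.log_pow,
        Real.log_mul (by positivity) (by positivity), Real.log_mul (by positivity) (by positivity),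
        Real.log_mul (by norm_num) (by positivity), Real.log_pow, hl4, ← hL₁, e2] at h3
      push_cast at h3
      have h4 : (n : ℝ) * (2 * Real.log 2) ≤ n * (2 * 0.7) := by gcongr
      linarith
    rcases le_total (2 * q₂ * δ ^ (m - l) * M ^ (n - m))
      (64 * M ^ 2 / q₂ ^ 3 * M ^ (n - 1)) with h | h
    · right
      have h3 := key (64 * M ^ 2 / q₂ ^ 3 * M ^ (n - 1)) (by positivity) (hle.trans (by
        gcongr
        have : ‖(p₂ : ℂ) - α i * q₂‖ * M ^ (n - 1) ≤ 64 * M ^ 2 / q₂ ^ 3 * M ^ (n - 1) := by gcongr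
        linarith))
      rw [Real.log_mul (by positivity) (by positivity), Real.log_div (by positivity) (by positivity),
        Real.log_mul (by norm_num) (by positivity), Real.log_pow, Real.log_pow, Real.log_pow, hl64,
        ← hΛ, ← hL₂, e2] at h3
      push_cast at h3
      linarith
    · left
      have h3 := key (2 * q₂ * δ ^ (m - l) * M ^ (n - m)) (by positivity) (hle.trans (by
        gcongr
        have : ‖(p₂ : ℂ) - α i * q₂‖ * M ^ (n - 1) ≤ 64 * M ^ 2 / q₂ ^ 3 * M ^ (n - 1) := by gcongr
        linarith))
      rw [Real.log_mul (by positivity) (by positivity), Real.log_mul (by positivity) (by positivity),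
        Real.log_mul (by positivity) (by positivity), Real.log_pow, Real.log_pow, ← hΛ, ← hL₂, e1,
        e3] at h3
      linarith

/-- The conclusion of Thue's method in terms of `Λ = log M`, `L₁ = log q₁` and `L₂ = log q₂`. -/
def ThueAlternative (Λ L₁ L₂ : ℝ) : Prop :=
  ∀ m n w : ℕ, n = 2 * m + w → 0 < w → w ≤ m → m ≤ 4 * w →
    ∃ l : ℕ, (l = 0 ∨ ((l : ℝ) - 1) * L₁ ≤ m * n / w * Λ + 100 * n) ∧ (l ≤ m →
      2 * l * L₁ ≤ (n - 1) * L₁ + m * n / (2 * w) * Λ + 100 * n + L₂ + (m - l) * (2 * Λ - 4 * L₁)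
        + (n - m) * Λ ∨
      2 * l * L₁ ≤ (n - 1) * L₁ + m * n / (2 * w) * Λ + 100 * n + (n + 1) * Λ - 3 * L₂)

theorem ThueAlternative.lower_bound {Λ L₁ L₂ : ℝ} (h : ThueAlternative Λ L₁ L₂) (hΛ : 0 ≤ Λ)
    (hL : Λ ≤ L₁) {m n w r : ℕ}
    (hn : n = 2 * m + w) (hw : 0 < w) (hwm : w ≤ m) (hmw : m ≤ 4 * w) (hr : r ≤ m)
    (h1 : m * n / w * Λ + 100 * n < r * L₁)
    (h2 : (n - 1) * L₁ + m * n / (2 * w) * Λ + 100 * n + (n + 1) * Λ < 3 * L₂) :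
    (4 * m - 2 * r - n + 1) * L₁ - (n + m - 2 * r) * Λ - m * n / (2 * w) * Λ - 100 * n ≤ L₂ := by
  obtain ⟨l, hl, hle⟩ := h m n w hn hw hwm hmw
  have hL0 : 0 ≤ L₁ := hΛ.trans hL
  have hlr : l ≤ r := by
    rcases hl with rfl | hl
    · exact Nat.zero_le _
    · by_contra! hlt
      have h3 : (r : ℝ) + 1 ≤ l := by exact_mod_cast hlt
      have h4 : (r : ℝ) * L₁ ≤ (l - 1) * L₁ := by gcongr; linarith
      linarith
  have hlr' : (l : ℝ) ≤ r := by exact_mod_cast hlr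
  have hl0 : (0 : ℝ) ≤ l := by positivity
  have h5 : 0 ≤ (r - l) * (L₁ - Λ) := mul_nonneg (by linarith) (by linarith)
  rcases hle (hlr.trans hr) with h3 | h3
  · nlinarith
  · have : 0 ≤ 2 * l * L₁ := by positivity
    linarith

theorem not_thueAlternative {Λ L₁ L₂ : ℝ} (hΛ : 10 ^ 6 ≤ Λ) (h₁ : 38 * Λ ≤ L₁)
    (h₂ : 3 * L₁ - 3 * Λ ≤ L₂) : ¬ ThueAlternative Λ L₁ L₂ := by
  intro h
  have hL : Λ ≤ L₁ := by linarith
  have hΛ0 : 0 ≤ Λ := by linarith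
  have hL0 : 0 ≤ L₁ := by linarith
  have s1 := h.lower_bound hΛ0 hL (m := 3) (n := 7) (w := 1) (r := 1) (by norm_num) (by norm_num)
    (by norm_num) (by norm_num) (by norm_num) (by norm_num; linarith) (by norm_num; linarith)
  norm_num at s1
  have s2 := h.lower_bound hΛ0 hL (m := 4) (n := 10) (w := 2) (r := 1) (by norm_num) (by norm_num)
    (by norm_num) (by norm_num) (by norm_num) (by norm_num; linarith) (by norm_num; linarith)
  norm_num at s2
  have s3 := h.lower_bound hΛ0 hL (m := 5) (n := 12) (w := 2) (r := 1) (by norm_num) (by norm_num)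
    (by norm_num) (by norm_num) (by norm_num) (by norm_num; linarith) (by norm_num; linarith)
  norm_num at s3
  have s4 := h.lower_bound hΛ0 hL (m := 7) (n := 16) (w := 2) (r := 2) (by norm_num) (by norm_num)
    (by norm_num) (by norm_num) (by norm_num) (by norm_num; linarith) (by norm_num; linarith)
  norm_num at s4
  have s5 := h.lower_bound hΛ0 hL (m := 9) (n := 21) (w := 3) (r := 2) (by norm_num) (by norm_num)
    (by norm_num) (by norm_num) (by norm_num) (by norm_num; linarith) (by norm_num; linarith)
  norm_num at s5
  have step : ∀ w : ℕ, 4 ≤ w → (7 * w - 1) * L₁ + 10.5 * w * Λ + 700 * w + (7 * w + 1) * Λ < 3 * L₂ →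
      (5 * w - 1) * L₁ - 62.5 * w * Λ - 2100 * w ≤ L₂ := by
    intro w hw hlow
    have hw4 : (4 : ℝ) ≤ w := by exact_mod_cast hw
    have hw0 : (w : ℝ) ≠ 0 := by positivity
    have hΛw : 10 ^ 6 * (w : ℝ) ≤ Λ * w := by gcongr
    have hLw : 38 * Λ * w ≤ L₁ * w := by gcongr
    obtain ⟨l, hl, hle⟩ := h (3 * w) (7 * w) w (by ring) (by omega) (by omega) (by omega)
    push_cast at hl hle
    have e1 : 3 * (w : ℝ) * (7 * w) / w * Λ = 21 * (w * Λ) := by field_simp; norm_num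
    have e2 : 3 * (w : ℝ) * (7 * w) / (2 * w) * Λ = 10.5 * (w * Λ) := by field_simp; norm_num
    rw [e1] at hl
    rw [e2] at hle
    have hl0 : (0 : ℝ) ≤ l := by positivity
    have hlb : l * L₁ ≤ L₁ + 21 * (w * Λ) + 700 * w := by
      rcases hl with rfl | hl
      · simp; positivity
      · linarith
    have hlw : l ≤ w := by
      by_contra! hlt
      have h3 : (w : ℝ) + 1 ≤ l := by exact_mod_cast hlt
      have h4 : ((w : ℝ) + 1) * L₁ ≤ l * L₁ := by gcongr
      linarith
    have h6 : 0 ≤ l * Λ := by positivity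
    have h7 : 0 ≤ l * L₁ := by positivity
    rcases hle (by omega) with h3 | h3
    · nlinarith
    · linarith
  have hall : ∀ w : ℕ, 4 ≤ w → (5 * w - 1) * L₁ - 62.5 * w * Λ - 2100 * w ≤ L₂ := by
    intro w hw
    induction w, hw using Nat.le_induction with
    | base => exact step 4 le_rfl (by norm_num; linarith)
    | succ w hw ih =>
      refine step (w + 1) (by omega) ?_
      have hw4 : (4 : ℝ) ≤ w := by exact_mod_cast hw
      have hΛw : 10 ^ 6 * (w : ℝ) ≤ Λ * w := by gcongr
      have hLw : 38 * Λ * (w - 4) ≤ L₁ * (w - 4) := mul_le_mul_of_nonneg_right h₁ (by linarith)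
      push_cast
      nlinarith
  obtain ⟨w, hw⟩ := exists_nat_gt (L₂ + L₁)
  have h4 := hall (w + 4) (by omega)
  have hΛw : 10 ^ 6 * (w : ℝ) ≤ Λ * w := by gcongr
  have hLw : 38 * Λ * w ≤ L₁ * w := by gcongr
  have hw0 : (0 : ℝ) ≤ w := by positivity
  push_cast at h4
  nlinarith

theorem pow_mul_norm_aeval_div_eq_prod {f : ℤ[X]} (hf : f.Monic) {x y : ℤ} (hy : 0 < y) :
    (y : ℝ) ^ f.natDegree * ‖aeval ((x : ℂ) / y) f‖ =
      ((f.map (Int.castRingHom ℂ)).roots.map fun z => ‖(x : ℂ) - z * y‖).prod := by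
  have hy' : (y : ℂ) ≠ 0 := by exact_mod_cast hy.ne'
  have hs := IsAlgClosed.splits (f.map (Int.castRingHom ℂ))
  have hcard : f.natDegree = (f.map (Int.castRingHom ℂ)).roots.card := by
    rw [← hs.natDegree_eq_card_roots, hf.natDegree_map]
  have hev : aeval ((x : ℂ) / y) f =
      ((f.map (Int.castRingHom ℂ)).roots.map fun z => (x : ℂ) / y - z).prod := by
    rw [← hs.eval_eq_prod_roots_of_monic (hf.map _), eval_map, aeval_def]
    rfl
  rw [hev, hcard]
  generalize (f.map (Int.castRingHom ℂ)).roots = s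
  induction s using Multiset.induction_on with
  | empty => simp
  | cons a s ih =>
    have h1 : ‖(x : ℂ) - a * y‖ = y * ‖(x : ℂ) / y - a‖ := by
      have h2 : (x : ℂ) - a * y = y * ((x : ℂ) / y - a) := by field_simp
      rw [h2, norm_mul, Complex.norm_intCast, abs_of_pos (by exact_mod_cast hy)]
    simp only [Multiset.map_cons, Multiset.prod_cons, Multiset.card_cons, norm_mul]
    rw [← ih, h1]
    ring

theorem Multiset.one_lt_prod_map {ι : Type*} {s : Multiset ι} {f : ι → ℝ} (hs : s ≠ 0)
    (h : ∀ z ∈ s, 1 < f z) : 1 < (s.map f).prod := by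
  induction s using Multiset.induction_on with
  | empty => exact absurd rfl hs
  | cons a s ih =>
    rw [Multiset.map_cons, Multiset.prod_cons]
    have ha := h a (Multiset.mem_cons_self a s)
    rcases eq_or_ne s 0 with rfl | hs0
    · simpa using ha
    · exact one_lt_mul_of_lt_of_le ha
        (ih hs0 fun z hz => h z (Multiset.mem_cons_of_mem hz)).le

/-- The monic integral quartic `F` with roots `α i` has Mahler measure `M` and discriminant of
absolute value at least `1`. -/
structure HasQuarticRoots (F : ℤ[X]) (α : Fin 4 → ℂ) (M : ℝ) : Prop where
  monic : F.Monic
  map_eq : F.map (Int.castRingHom ℂ) = ∏ i, (X - C (α i))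
  measure_eq : M = ∏ i, max 1 ‖α i‖
  one_le_disc : 1 ≤ ∏ i, ∏ j ∈ Finset.univ.erase i, ‖α i - α j‖

/-- The product of the linear factors of the quartic form being of absolute value one. -/
def IsUnitValue (α : Fin 4 → ℂ) (x y : ℤ) : Prop := ∏ i, ‖(x : ℂ) - α i * y‖ = 1

namespace HasQuarticRoots

variable {F : ℤ[X]} {α : Fin 4 → ℂ} {M : ℝ}

theorem injective (h : HasQuarticRoots F α M) : Function.Injective α := by
  intro i j hij
  by_contra hne
  have h0 : ∏ i, ∏ j ∈ Finset.univ.erase i, ‖α i - α j‖ = 0 :=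
    Finset.prod_eq_zero (Finset.mem_univ i) (Finset.prod_eq_zero (i := j)
      (Finset.mem_erase.mpr ⟨Ne.symm hne, Finset.mem_univ j⟩) (by simp [hij]))
  have := h.one_le_disc
  linarith

theorem roots_eq (h : HasQuarticRoots F α M) :
    (F.map (Int.castRingHom ℂ)).roots = Finset.univ.val.map α := by
  rw [h.map_eq, ← roots_multiset_prod_X_sub_C (Finset.univ.val.map α), Multiset.map_map]
  rfl

theorem natDegree_eq (h : HasQuarticRoots F α M) : F.natDegree = 4 := by
  rw [← h.monic.natDegree_map (Int.castRingHom ℂ), h.map_eq, natDegree_prod_of_monic _ _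
    fun i _ => monic_X_sub_C _]
  simp

theorem aeval_eq_zero (h : HasQuarticRoots F α M) (i : Fin 4) : aeval (α i) F = 0 := by
  have : eval (α i) (F.map (Int.castRingHom ℂ)) = 0 := by
    rw [h.map_eq, eval_prod]
    exact Finset.prod_eq_zero (Finset.mem_univ i) (by simp)
  rwa [eval_map] at this

theorem comp_perm (h : HasQuarticRoots F α M) (σ : Equiv.Perm (Fin 4)) :
    HasQuarticRoots F (α ∘ σ) M where
  monic := h.monic
  map_eq := by rw [h.map_eq]; exact (Equiv.prod_comp σ fun i => X - C (α i)).symm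
  measure_eq := by rw [h.measure_eq]; exact (Equiv.prod_comp σ fun i => max 1 ‖α i‖).symm
  one_le_disc := by
    refine h.one_le_disc.trans_eq ?_
    rw [← Equiv.prod_comp σ]
    refine Finset.prod_congr rfl fun i _ => ?_
    refine (Finset.prod_equiv σ (by simp) ?_).symm
    simp

theorem one_le_M (h : HasQuarticRoots F α M) : 1 ≤ M := by
  rw [h.measure_eq]
  exact Finset.one_le_prod fun i _ => le_max_left _ _

theorem not_factor (h : HasQuarticRoots F α M) {x y : ℤ} (hy : 0 < y) (hs : IsUnitValue α x y)
    {j : Fin 4} (hfar : ∀ i, i ≠ j → 1 < ‖(x : ℂ) - α i * y‖) {f g : ℤ[X]} (hf : f.Monic)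
    (hg : g.Monic) (hfg : f * g = F) (hd : f.natDegree ≠ 0) (hj : aeval (α j) f ≠ 0) : False := by
  have h1 : 1 < (y : ℝ) ^ f.natDegree * ‖aeval ((x : ℂ) / y) f‖ := by
    rw [pow_mul_norm_aeval_div_eq_prod hf hy]
    refine Multiset.one_lt_prod_map ?_ fun z hz => ?_
    · rw [← Multiset.card_pos, ← (IsAlgClosed.splits _).natDegree_eq_card_roots, hf.natDegree_map]
      omega
    · have hzf : aeval z f = 0 := by
        have := (mem_roots'.mp hz).2
        rwa [IsRoot.def, eval_map] at this
      have hz' : z ∈ (F.map (Int.castRingHom ℂ)).roots := by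
        rw [mem_roots (h.monic.map _).ne_zero, IsRoot.def, ← hfg, Polynomial.map_mul, eval_mul,
          (mem_roots'.mp hz).2, zero_mul]
      rw [h.roots_eq] at hz'
      obtain ⟨i, -, rfl⟩ := Multiset.mem_map.mp hz'
      exact hfar i fun hij => hj (hij ▸ hzf)
  have h2 : (y : ℝ) ^ f.natDegree * ‖aeval ((x : ℂ) / y) f‖ *
      ((y : ℝ) ^ g.natDegree * ‖aeval ((x : ℂ) / y) g‖) = 1 := by
    have h3 := pow_mul_norm_aeval_div_eq_prod h.monic hy (x := x)
    rw [h.roots_eq, Multiset.map_map] at h3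
    have h4 : (Finset.univ.val.map ((fun z => ‖(x : ℂ) - z * y‖) ∘ α)).prod = 1 := hs
    rw [h4, ← hfg, hf.natDegree_mul hg, map_mul, norm_mul, pow_add] at h3
    linarith
  have h5 : 1 ≤ (y : ℝ) ^ g.natDegree * ‖aeval ((x : ℂ) / y) g‖ := by
    refine one_le_pow_mul_norm_aeval_div hy fun h0 => ?_
    rw [h0] at h2
    simp at h2
  nlinarith

theorem irreducible (h : HasQuarticRoots F α M) {x y : ℤ} (hy : 0 < y) (hs : IsUnitValue α x y)
    {j : Fin 4} (hfar : ∀ i, i ≠ j → 1 < ‖(x : ℂ) - α i * y‖) : Irreducible F := by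
  have hdeg := h.natDegree_eq
  rw [h.monic.irreducible_iff_natDegree']
  refine ⟨fun h1 => by rw [h1] at hdeg; simp at hdeg, fun f g hf hg hfg hmem => ?_⟩
  rw [Finset.mem_Ioc, hdeg] at hmem
  have hd : f.natDegree + g.natDegree = 4 := by rw [← hf.natDegree_mul hg, hfg, hdeg]
  by_cases hj : aeval (α j) f = 0
  · by_cases hj' : aeval (α j) g = 0
    · have hnd : (F.map (Int.castRingHom ℂ)).roots.Nodup := by
        rw [h.roots_eq]
        exact (Multiset.nodup_map_iff_of_injective h.injective).mpr Finset.univ.nodup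
      rw [← hfg, Polynomial.map_mul, roots_mul (((hf.map _).mul (hg.map _)).ne_zero),
        Multiset.nodup_add] at hnd
      have hmem' : ∀ {k : ℤ[X]}, k.Monic → aeval (α j) k = 0 →
          α j ∈ (k.map (Int.castRingHom ℂ)).roots := fun hk hk0 => by
        rw [mem_roots (hk.map _).ne_zero, IsRoot.def, eval_map]
        exact hk0
      exact Multiset.disjoint_left.mp hnd.2.2 (hmem' hf hj) (hmem' hg hj')
    · exact h.not_factor hy hs hfar hg hf (by rw [mul_comm, hfg]) (by omega) hj'
  · exact h.not_factor hy hs hfar hf hg hfg (by omega) hj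

theorem aeval_conjugate_eq_zero (h : HasQuarticRoots F α M) (hF : Irreducible F) (T : ℤ[X])
    (i : Fin 4) (hT : aeval (α i) T = 0) (j : Fin 4) : aeval (α j) T = 0 := by
  have h_integral : IsIntegral ℤ (α i) := ⟨F, h.monic, h.aeval_eq_zero i⟩
  have h1 := minpoly.isIntegrallyClosed_dvd h_integral (h.aeval_eq_zero i)
  have h2 : Associated (minpoly ℤ (α i)) F :=
    associated_of_dvd_dvd h1 ((hF.dvd_iff.mp h1).resolve_left (minpoly.not_isUnit _ _)).dvd
  obtain ⟨U, rfl⟩ := h2.symm.dvd.trans (minpoly.isIntegrallyClosed_dvd h_integral hT)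
  rw [map_mul, h.aeval_eq_zero, zero_mul]

end HasQuarticRoots

/-- The absolute value of the derivative of `∏ (X - α i)` at its root `α j`. -/
noncomputable def rootSeparation (α : Fin 4 → ℂ) (j : Fin 4) : ℝ :=
  ∏ k ∈ Finset.univ.erase j, ‖α j - α k‖

theorem rootSeparation_comp_perm (α : Fin 4 → ℂ) (σ : Equiv.Perm (Fin 4)) (j : Fin 4) :
    rootSeparation (α ∘ σ) j = rootSeparation α (σ j) :=
  Finset.prod_equiv σ (by simp) (by simp)

theorem rootSeparation_zero (α : Fin 4 → ℂ) :
    rootSeparation α 0 = ‖α 0 - α 1‖ * ‖α 0 - α 2‖ * ‖α 0 - α 3‖ := by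
  have : Finset.univ.erase (0 : Fin 4) = {1, 2, 3} := by decide
  rw [rootSeparation, this]
  simp [mul_assoc]

theorem exists_perm_eq (i j : Fin 4) (h : i ≠ j) : ∃ σ : Equiv.Perm (Fin 4), σ 0 = i ∧ σ 1 = j := by
  revert i j
  decide

theorem norm_sub_le_two_mul (z w : ℂ) : ‖z - w‖ ≤ 2 * (max 1 ‖z‖ * max 1 ‖w‖) := by
  have h1 := norm_sub_le z w
  have hz := le_max_left 1 ‖z‖
  have hw := le_max_left 1 ‖w‖
  have hz' := le_max_right 1 ‖z‖
  have hw' := le_max_right 1 ‖w‖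
  nlinarith

namespace HasQuarticRoots

variable {F : ℤ[X]} {α : Fin 4 → ℂ} {M : ℝ}

theorem one_le_prod_norm_sub (h : HasQuarticRoots F α M) :
    1 ≤ ‖α 0 - α 1‖ * ‖α 0 - α 2‖ * ‖α 0 - α 3‖ * (‖α 1 - α 2‖ * ‖α 1 - α 3‖ * ‖α 2 - α 3‖) := by
  have h1 := h.one_le_disc
  have e0 : Finset.univ.erase (0 : Fin 4) = {1, 2, 3} := by decide
  have e1 : Finset.univ.erase (1 : Fin 4) = {0, 2, 3} := by decide
  have e2 : Finset.univ.erase (2 : Fin 4) = {0, 1, 3} := by decide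
  have e3 : Finset.univ.erase (3 : Fin 4) = {0, 1, 2} := by decide
  rw [Fin.prod_univ_four, e0, e1, e2, e3] at h1
  simp only [Finset.mem_insert, Finset.mem_singleton, Fin.reduceEq, or_self, not_false_eq_true,
    Finset.prod_insert, Finset.prod_singleton] at h1
  rw [norm_sub_rev (α 1) (α 0), norm_sub_rev (α 2) (α 0), norm_sub_rev (α 2) (α 1),
    norm_sub_rev (α 3) (α 0), norm_sub_rev (α 3) (α 1), norm_sub_rev (α 3) (α 2)] at h1
  refine (one_le_sq_iff₀ (by positivity)).mp (h1.trans_eq (by ring))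

theorem bounds_zero (h : HasQuarticRoots F α M) :
    1 ≤ 8 * M ^ 2 * rootSeparation α 0 ∧ rootSeparation α 0 ≤ 8 * M ^ 3 ∧
      1 ≤ 32 * M ^ 3 * ‖α 0 - α 1‖ ∧ rootSeparation α 0 ≤ 4 * M ^ 2 * ‖α 0 - α 1‖ := by
  have hP := h.one_le_prod_norm_sub
  have hM := h.measure_eq
  rw [Fin.prod_univ_four] at hM
  rw [rootSeparation_zero]
  have h01 := norm_sub_le_two_mul (α 0) (α 1)
  have h02 := norm_sub_le_two_mul (α 0) (α 2)
  have h03 := norm_sub_le_two_mul (α 0) (α 3)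
  have h12 := norm_sub_le_two_mul (α 1) (α 2)
  have h13 := norm_sub_le_two_mul (α 1) (α 3)
  have h23 := norm_sub_le_two_mul (α 2) (α 3)
  have n01 := norm_nonneg (α 0 - α 1)
  generalize ‖α 0 - α 1‖ = d01 at *
  have n02 := norm_nonneg (α 0 - α 2)
  generalize ‖α 0 - α 2‖ = d02 at *
  have n03 := norm_nonneg (α 0 - α 3)
  generalize ‖α 0 - α 3‖ = d03 at *
  have n12 := norm_nonneg (α 1 - α 2)
  generalize ‖α 1 - α 2‖ = d12 at *
  have n13 := norm_nonneg (α 1 - α 3)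
  generalize ‖α 1 - α 3‖ = d13 at *
  have n23 := norm_nonneg (α 2 - α 3)
  generalize ‖α 2 - α 3‖ = d23 at *
  have m0 := le_max_left 1 ‖α 0‖
  generalize max 1 ‖α 0‖ = a at *
  have m1 := le_max_left 1 ‖α 1‖
  generalize max 1 ‖α 1‖ = b at *
  have m2 := le_max_left 1 ‖α 2‖
  generalize max 1 ‖α 2‖ = c at *
  have m3 := le_max_left 1 ‖α 3‖
  generalize max 1 ‖α 3‖ = d at *
  have a0 : 0 < a := by linarith
  have b0 : 0 < b := by linarith
  have c0 : 0 < c := by linarith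
  have d0 : 0 < d := by linarith
  subst hM
  have k1 : d12 * d13 * d23 ≤ 8 * (a * b * c * d) ^ 2 :=
    calc d12 * d13 * d23 ≤ 2 * (b * c) * (2 * (b * d)) * (2 * (c * d)) := by gcongr
      _ = 8 * (1 * b * c * d) ^ 2 := by ring
      _ ≤ 8 * (a * b * c * d) ^ 2 := by gcongr
  have k2 : d02 * d03 ≤ 4 * (a * b * c * d) ^ 2 :=
    calc d02 * d03 ≤ 2 * (a * c) * (2 * (a * d)) := by gcongr
      _ = 4 * (a ^ 2 * 1 ^ 2 * (c ^ 1 * d ^ 1)) := by ring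
      _ ≤ 4 * (a ^ 2 * b ^ 2 * (c ^ 2 * d ^ 2)) := by gcongr <;> norm_num
      _ = 4 * (a * b * c * d) ^ 2 := by ring
  refine ⟨?_, ?_, ?_, ?_⟩
  · calc 1 ≤ d01 * d02 * d03 * (d12 * d13 * d23) := hP
      _ ≤ d01 * d02 * d03 * (8 * (a * b * c * d) ^ 2) := by gcongr
      _ = _ := by ring
  · calc d01 * d02 * d03 ≤ 2 * (a * b) * (2 * (a * c)) * (2 * (a * d)) := by gcongr
      _ = 8 * (a ^ 3 * (b ^ 1 * c ^ 1 * d ^ 1)) := by ring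
      _ ≤ 8 * (a ^ 3 * (b ^ 3 * c ^ 3 * d ^ 3)) := by gcongr <;> norm_num
      _ = _ := by ring
  · calc 1 ≤ d01 * d02 * d03 * (d12 * d13 * d23) := hP
      _ ≤ d01 * (2 * (a * c)) * (2 * (a * d)) * (2 * (b * c) * (2 * (b * d)) * (2 * (c * d))) := by
        gcongr
      _ = 32 * d01 * (a ^ 2 * b ^ 2 * (c ^ 3 * d ^ 3)) := by ring
      _ ≤ 32 * d01 * (a ^ 3 * b ^ 3 * (c ^ 3 * d ^ 3)) := by gcongr <;> norm_num
      _ = _ := by ring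
  · calc d01 * d02 * d03 = d01 * (d02 * d03) := by ring
      _ ≤ d01 * (4 * (a * b * c * d) ^ 2) := by gcongr
      _ = _ := by ring

theorem bounds (h : HasQuarticRoots F α M) {i j : Fin 4} (hij : i ≠ j) :
    1 ≤ 8 * M ^ 2 * rootSeparation α i ∧ rootSeparation α i ≤ 8 * M ^ 3 ∧
      1 ≤ 32 * M ^ 3 * ‖α i - α j‖ ∧ rootSeparation α i ≤ 4 * M ^ 2 * ‖α i - α j‖ := by
  obtain ⟨σ, rfl, rfl⟩ := exists_perm_eq i j hij
  simpa only [rootSeparation_comp_perm, Function.comp_apply] using (h.comp_perm σ).bounds_zero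

theorem one_le_mul_rootSeparation (h : HasQuarticRoots F α M) (j : Fin 4) :
    1 ≤ 8 * M ^ 2 * rootSeparation α j := by
  obtain ⟨i, hi⟩ := exists_ne j
  exact (h.bounds hi.symm).1

theorem rootSeparation_le (h : HasQuarticRoots F α M) (j : Fin 4) :
    rootSeparation α j ≤ 8 * M ^ 3 := by
  obtain ⟨i, hi⟩ := exists_ne j
  exact (h.bounds hi.symm).2.1

theorem rootSeparation_pos (h : HasQuarticRoots F α M) (j : Fin 4) : 0 < rootSeparation α j := by
  have h1 := h.one_le_mul_rootSeparation j
  have h2 : 0 ≤ 8 * M ^ 2 := by positivity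
  exact pos_of_mul_pos_right (by linarith) h2

theorem norm_linear_pos {x y : ℤ} (hs : IsUnitValue α x y) (i : Fin 4) :
    0 < ‖(x : ℂ) - α i * y‖ := by
  refine norm_pos_iff.mpr fun h0 => ?_
  have : ∏ i, ‖(x : ℂ) - α i * y‖ = 0 := Finset.prod_eq_zero (Finset.mem_univ i) (by rw [h0, norm_zero])
  rw [IsUnitValue, this] at hs
  norm_num at hs

theorem norm_sub_mul_le {x y : ℤ} (hy : 0 < y) (i j : Fin 4) :
    ‖α i - α j‖ * y ≤ ‖(x : ℂ) - α i * y‖ + ‖(x : ℂ) - α j * y‖ := by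
  have h1 : ((α i - α j) * y : ℂ) = (x - α j * y) - (x - α i * y) := by ring
  have h2 : ‖α i - α j‖ * y = ‖((α i - α j) * y : ℂ)‖ := by
    rw [norm_mul, Complex.norm_intCast, abs_of_pos (by exact_mod_cast hy)]
  rw [h2, h1, add_comm]
  exact norm_sub_le _ _

theorem nearest_bound {x y : ℤ} (hy : 0 < y) (hs : IsUnitValue α x y) {j : Fin 4}
    (hj : ∀ i, ‖(x : ℂ) - α j * y‖ ≤ ‖(x : ℂ) - α i * y‖) :
    ‖(x : ℂ) - α j * y‖ * y ^ 3 * rootSeparation α j ≤ 8 := by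
  have hy' : (0 : ℝ) < y := by exact_mod_cast hy
  have h1 : ∏ k ∈ Finset.univ.erase j, (‖α j - α k‖ * y) ≤
      ∏ k ∈ Finset.univ.erase j, (2 * ‖(x : ℂ) - α k * y‖) := by
    refine Finset.prod_le_prod (fun _ _ => by positivity) fun k _ => ?_
    have := norm_sub_mul_le (α := α) (x := x) hy j k
    linarith [hj k]
  rw [Finset.prod_mul_distrib, Finset.prod_mul_distrib, Finset.prod_const, Finset.prod_const,
    Finset.card_erase_of_mem (Finset.mem_univ _), Finset.card_univ, Fintype.card_fin] at h1
  have h2 : ‖(x : ℂ) - α j * y‖ * ∏ k ∈ Finset.univ.erase j, ‖(x : ℂ) - α k * y‖ = 1 := by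
    exact (Finset.mul_prod_erase _ (fun k => ‖(x : ℂ) - α k * y‖) (Finset.mem_univ j)).trans hs
  rw [rootSeparation]
  calc _ = ‖(x : ℂ) - α j * y‖ * ((∏ k ∈ Finset.univ.erase j, ‖α j - α k‖) * (y : ℝ) ^ (4 - 1)) := by
        norm_num; ring
    _ ≤ ‖(x : ℂ) - α j * y‖ * (2 ^ (4 - 1) * ∏ k ∈ Finset.univ.erase j, ‖(x : ℂ) - α k * y‖) := by
        gcongr
    _ = 2 ^ (4 - 1) * (‖(x : ℂ) - α j * y‖ * ∏ k ∈ Finset.univ.erase j, ‖(x : ℂ) - α k * y‖) := by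
        ring
    _ = 8 := by rw [h2]; norm_num

theorem norm_linear_le (h : HasQuarticRoots F α M) {x y : ℤ} (hy : 0 < y)
    (hs : IsUnitValue α x y) {j : Fin 4}
    (hj : ∀ i, ‖(x : ℂ) - α j * y‖ ≤ ‖(x : ℂ) - α i * y‖) :
    ‖(x : ℂ) - α j * y‖ * y ^ 3 ≤ 64 * M ^ 2 := by
  have hy' : (0 : ℝ) < y := by exact_mod_cast hy
  have h1 := nearest_bound hy hs hj
  have h2 := h.one_le_mul_rootSeparation j
  have h3 : 0 ≤ ‖(x : ℂ) - α j * y‖ * y ^ 3 := by positivity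
  calc _ ≤ ‖(x : ℂ) - α j * y‖ * y ^ 3 * (8 * M ^ 2 * rootSeparation α j) :=
        le_mul_of_one_le_right h3 h2
    _ = 8 * M ^ 2 * (‖(x : ℂ) - α j * y‖ * y ^ 3 * rootSeparation α j) := by ring
    _ ≤ 8 * M ^ 2 * 8 := by gcongr
    _ = _ := by ring

end HasQuarticRoots

namespace HasQuarticRoots

variable {F : ℤ[X]} {α : Fin 4 → ℂ} {M : ℝ}

theorem isCoprime (h : HasQuarticRoots F α M) {x y : ℤ} (hy : 0 < y) (hs : IsUnitValue α x y) :
    IsCoprime x y := by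
  rw [Int.isCoprime_iff_gcd_eq_one]
  have hg : 0 < x.gcd y := Int.gcd_pos_of_ne_zero_right _ hy.ne'
  obtain ⟨u, hu⟩ := Int.gcd_dvd_left x y
  obtain ⟨v, hv⟩ := Int.gcd_dvd_right x y
  set g := x.gcd y
  have hv0 : 0 < v := by
    have : (0 : ℤ) < g * v := hv ▸ hy
    exact pos_of_mul_pos_right this (by positivity)
  have h1 : (g : ℝ) ^ 4 * ∏ i, ‖(u : ℂ) - α i * v‖ = 1 := by
    rw [← hs]
    have h2 : ∀ i, ‖(x : ℂ) - α i * y‖ = g * ‖(u : ℂ) - α i * v‖ := fun i => by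
      have h3 : (x : ℂ) - α i * y = (g : ℂ) * (u - α i * v) := by
        rw [hu, hv]; push_cast; ring
      rw [h3, norm_mul, Complex.norm_natCast]
    simp_rw [h2, Finset.prod_mul_distrib, Finset.prod_const, Finset.card_univ, Fintype.card_fin]
  have h2 : ∏ i, ‖(u : ℂ) - α i * v‖ = (v : ℝ) ^ F.natDegree * ‖aeval ((u : ℂ) / v) F‖ := by
    rw [pow_mul_norm_aeval_div_eq_prod h.monic hv0, h.roots_eq, Multiset.map_map]
    rfl
  have h3 : 1 ≤ ∏ i, ‖(u : ℂ) - α i * v‖ := by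
    rw [h2]
    refine one_le_pow_mul_norm_aeval_div hv0 fun h0 => ?_
    rw [h2, h0] at h1
    simp at h1
  by_contra hne
  have h4 : (2 : ℝ) ≤ g := by exact_mod_cast (by omega : 2 ≤ g)
  have h5 : (2 : ℝ) ^ 4 ≤ (g : ℝ) ^ 4 := by gcongr
  nlinarith

theorem det_ne_zero (h : HasQuarticRoots F α M) {x y x' y' : ℤ} (hy : 0 < y) (hy' : 0 < y')
    (hs : IsUnitValue α x y) (hs' : IsUnitValue α x' y') (hne : (x, y) ≠ (x', y')) :
    x * y' - x' * y ≠ 0 := by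
  intro h0
  have hc := h.isCoprime hy hs
  have hc' := h.isCoprime hy' hs'
  have h1 : y ∣ y' := hc.symm.dvd_of_dvd_mul_left ⟨x', by linarith⟩
  have h2 : y' ∣ y := hc'.symm.dvd_of_dvd_mul_left ⟨x, by linarith⟩
  have h3 : y = y' := Int.dvd_antisymm hy.le hy'.le h1 h2
  subst h3
  have h4 : (x - x') * y = 0 := by linarith
  rcases mul_eq_zero.mp h4 with h5 | h5
  · exact hne (by rw [sub_eq_zero.mp h5])
  · omega

theorem one_le_cross {x y x' y' : ℤ} (hy : 0 < y) (hy' : 0 < y') (hdet : x * y' - x' * y ≠ 0)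
    (z : ℂ) : 1 ≤ y * ‖(x' : ℂ) - z * y'‖ + y' * ‖(x : ℂ) - z * y‖ := by
  have hyr : (0 : ℝ) < y := by exact_mod_cast hy
  have hyr' : (0 : ℝ) < y' := by exact_mod_cast hy'
  have h1 : ((x * y' - x' * y : ℤ) : ℂ) = y' * (x - z * y) - y * (x' - z * y') := by
    push_cast; ring
  have h2 : (1 : ℝ) ≤ ‖((x * y' - x' * y : ℤ) : ℂ)‖ := by
    rw [Complex.norm_intCast]
    exact_mod_cast Int.one_le_abs hdet
  rw [h1] at h2
  refine h2.trans ((norm_sub_le _ _).trans_eq ?_)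
  rw [norm_mul, norm_mul, Complex.norm_intCast, Complex.norm_intCast, abs_of_pos hyr,
    abs_of_pos hyr', add_comm]

/-- Two good approximations to the same root repel each other. -/
theorem one_le_of_close {x y x' y' : ℤ} (hy : 0 < y) (hyy : y ≤ y')
    (hdet : x * y' - x' * y ≠ 0) {z : ℂ} (hc' : 2 * y' * ‖(x' : ℂ) - z * y'‖ ≤ 1) :
    1 ≤ 2 * y' * ‖(x : ℂ) - z * y‖ := by
  have h1 := one_le_cross hy (hy.trans_le hyy) hdet z
  have h2 : (y : ℝ) * ‖(x' : ℂ) - z * y'‖ ≤ y' * ‖(x' : ℂ) - z * y'‖ := by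
    have : (y : ℝ) ≤ y' := by exact_mod_cast hyy
    gcongr
  linarith

theorem log_gap (h : HasQuarticRoots F α M) {x y x' y' : ℤ} (hy : 0 < y) (hyy : y ≤ y')
    (hdet : x * y' - x' * y ≠ 0) (hs : IsUnitValue α x y) {j : Fin 4}
    (hj : ∀ i, ‖(x : ℂ) - α j * y‖ ≤ ‖(x : ℂ) - α i * y‖)
    (hc' : 2 * y' * ‖(x' : ℂ) - α j * y'‖ ≤ 1) :
    3 * Real.log y + Real.log (rootSeparation α j) - 3 ≤ Real.log y' := by
  have hyr : (0 : ℝ) < y := by exact_mod_cast hy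
  have hyr' : (0 : ℝ) < y' := by exact_mod_cast hy.trans_le hyy
  have hd := h.rootSeparation_pos j
  have h1 := one_le_of_close hy hyy hdet hc'
  have h2 := nearest_bound hy hs hj
  have h3 : (y : ℝ) ^ 3 * rootSeparation α j ≤ 2 ^ 4 * y' :=
    calc (y : ℝ) ^ 3 * rootSeparation α j
        ≤ (y : ℝ) ^ 3 * rootSeparation α j * (2 * y' * ‖(x : ℂ) - α j * y‖) :=
          le_mul_of_one_le_right (by positivity) h1
      _ = 2 * y' * (‖(x : ℂ) - α j * y‖ * y ^ 3 * rootSeparation α j) := by ring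
      _ ≤ 2 * y' * 8 := by gcongr
      _ = _ := by ring
  have h4 := Real.log_le_log (by positivity) h3
  rw [Real.log_mul (by positivity) hd.ne', Real.log_mul (by positivity) hyr'.ne', Real.log_pow,
    Real.log_pow] at h4
  have := Real.log_two_lt_d9
  push_cast at h4
  linarith

theorem log_le_of_not_nearest (h : HasQuarticRoots F α M) {x y : ℤ} (hy : 0 < y) {j : Fin 4}
    (hj : ¬ ∀ i, ‖(x : ℂ) - α j * y‖ ≤ ‖(x : ℂ) - α i * y‖)
    (hc : 2 * y * ‖(x : ℂ) - α j * y‖ ≤ 1) :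
    2 * Real.log y ≤ 2 * Real.log M - Real.log (rootSeparation α j) + 2 := by
  have hyr : (0 : ℝ) < y := by exact_mod_cast hy
  push Not at hj
  obtain ⟨i, hi⟩ := hj
  have hij : j ≠ i := by rintro rfl; exact lt_irrefl _ hi
  have hM := h.one_le_M
  have hd := h.rootSeparation_pos j
  have h1 := norm_sub_mul_le (α := α) (x := x) hy j i
  have h2 := (h.bounds hij).2.2.2
  have h3 : rootSeparation α j * y ^ 2 ≤ 2 ^ 2 * M ^ 2 :=
    calc rootSeparation α j * y ^ 2 ≤ 4 * M ^ 2 * ‖α j - α i‖ * y ^ 2 := by gcongr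
      _ = 4 * M ^ 2 * (y * (‖α j - α i‖ * y)) := by ring
      _ ≤ 4 * M ^ 2 * (y * (2 * ‖(x : ℂ) - α j * y‖)) :=
        mul_le_mul_of_nonneg_left (mul_le_mul_of_nonneg_left (by linarith) hyr.le) (by positivity)
      _ = 4 * M ^ 2 * (2 * y * ‖(x : ℂ) - α j * y‖) := by ring
      _ ≤ 4 * M ^ 2 * 1 := by gcongr
      _ = _ := by ring
  have h4 := Real.log_le_log (by positivity) h3
  rw [Real.log_mul hd.ne' (by positivity), Real.log_mul (by positivity) (by positivity),
    Real.log_pow, Real.log_pow, Real.log_pow] at h4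
  have := Real.log_two_lt_d9
  push_cast at h4
  linarith

theorem log_rootSeparation_ge (h : HasQuarticRoots F α M) (j : Fin 4) :
    -2 * Real.log M - 3 ≤ Real.log (rootSeparation α j) := by
  have hM := h.one_le_M
  have hd := h.rootSeparation_pos j
  have h1 := h.one_le_mul_rootSeparation j
  rw [show (8 : ℝ) = 2 ^ 3 by norm_num] at h1
  have h4 := Real.log_le_log one_pos h1
  rw [Real.log_mul (by positivity) hd.ne', Real.log_mul (by positivity) (by positivity),
    Real.log_pow, Real.log_pow, Real.log_one] at h4
  have := Real.log_two_lt_d9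
  push_cast at h4
  linarith

theorem log_rootSeparation_le (h : HasQuarticRoots F α M) (j : Fin 4) :
    Real.log (rootSeparation α j) ≤ 3 * Real.log M + 3 := by
  have hM := h.one_le_M
  have hd := h.rootSeparation_pos j
  have h1 := h.rootSeparation_le j
  rw [show (8 : ℝ) = 2 ^ 3 by norm_num] at h1
  have h4 := Real.log_le_log hd h1
  rw [Real.log_mul (by positivity) (by positivity), Real.log_pow, Real.log_pow] at h4
  have := Real.log_two_lt_d9
  push_cast at h4
  linarith

theorem sum_log_rootSeparation (h : HasQuarticRoots F α M) :
    0 ≤ ∑ j, Real.log (rootSeparation α j) := by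
  rw [← Real.log_prod fun j _ => (h.rootSeparation_pos j).ne']
  exact Real.log_nonneg h.one_le_disc

/-- A very large solution has no solution of much larger size close to the same root. -/
theorem no_large_gap (h : HasQuarticRoots F α M) (hΛ : 10 ^ 6 ≤ Real.log M) {j : Fin 4}
    {x y x' y' : ℤ} (hy : 0 < y) (hy' : 0 < y') (hs : IsUnitValue α x y)
    (hs' : IsUnitValue α x' y') (hj : ∀ i, ‖(x : ℂ) - α j * y‖ ≤ ‖(x : ℂ) - α i * y‖)
    (hj' : ∀ i, ‖(x' : ℂ) - α j * y'‖ ≤ ‖(x' : ℂ) - α i * y'‖)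
    (hbig : 38 * Real.log M ≤ Real.log y) :
    Real.log y' < 3 * Real.log y - 3 * Real.log M := by
  by_contra! hgap
  have hyr : (0 : ℝ) < y := by exact_mod_cast hy
  have hM := h.one_le_M
  have hlarge : 64 * M ^ 3 < y := by
    rw [← Real.log_lt_log_iff (by positivity) hyr, show (64 : ℝ) = 2 ^ 6 by norm_num,
      Real.log_mul (by positivity) (by positivity), Real.log_pow, Real.log_pow]
    have := Real.log_two_lt_d9
    push_cast
    linarith
  have hfar : ∀ i, i ≠ j → 1 < ‖(x : ℂ) - α i * y‖ := fun i hi => by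
    have h1 := norm_sub_mul_le (α := α) (x := x) hy i j
    have h2 := (h.bounds hi).2.2.1
    have h3 : 64 * M ^ 3 * ‖α i - α j‖ < y * ‖α i - α j‖ := by
      have : 0 < ‖α i - α j‖ := norm_pos_iff.mpr (sub_ne_zero.mpr (h.injective.ne hi))
      gcongr
    linarith [hj i]
  have hirr := h.irreducible hy hs hfar
  refine not_thueAlternative hΛ hbig hgap fun m n w hn hw hwm hmw => ?_
  exact thue_inequality_log h.monic h.map_eq h.injective
    (fun T i hT k => h.aeval_conjugate_eq_zero hirr T i hT k) h.measure_eq j (h.isCoprime hy hs)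
    hy hy' rfl rfl rfl (h.norm_linear_le hy hs hj) (h.norm_linear_le hy' hs' hj') (by linarith)
    hn hw hwm hmw

/-- The smallest of five solutions close to the same root is small. -/
theorem log_smallest_le (h : HasQuarticRoots F α M) (hΛ : 10 ^ 6 ≤ Real.log M) {j : Fin 4}
    {x y : Fin 5 → ℤ} (hy : ∀ t, 0 < y t) (hmono : Monotone y)
    (hne : Function.Injective fun t => (x t, y t)) (hs : ∀ t, IsUnitValue α (x t) (y t))
    (hc : ∀ t, 2 * y t * ‖(x t : ℂ) - α j * y t‖ ≤ 1) :
    Real.log (y 0) ≤ (39 * Real.log M - 13 * Real.log (rootSeparation α j)) / 27 + 2 := by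
  have hD1 := h.log_rootSeparation_ge j
  have hD2 := h.log_rootSeparation_le j
  have hdet : ∀ t t', t ≠ t' → x t * y t' - x t' * y t ≠ 0 := fun t t' htt =>
    h.det_ne_zero (hy t) (hy t') (hs t) (hs t') (hne.ne htt)
  have hlog : ∀ t, Real.log (y 0) ≤ Real.log (y t) := fun t =>
    Real.log_le_log (by exact_mod_cast hy 0) (by exact_mod_cast hmono (Fin.zero_le t))
  have hgap : ∀ t t' : Fin 5, t < t' →
      (∀ i, ‖(x t : ℂ) - α j * y t‖ ≤ ‖(x t : ℂ) - α i * y t‖) →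
      3 * Real.log (y t) + Real.log (rootSeparation α j) - 3 ≤ Real.log (y t') := fun t t' htt hj =>
    h.log_gap (hy t) (hmono htt.le) (hdet t t' htt.ne) (hs t) hj (hc t')
  have hfar : ∀ t : Fin 5, ¬ (∀ i, ‖(x t : ℂ) - α j * y t‖ ≤ ‖(x t : ℂ) - α i * y t‖) →
      2 * Real.log (y t) ≤ 2 * Real.log M - Real.log (rootSeparation α j) + 2 := fun t hj =>
    h.log_le_of_not_nearest (hy t) hj (hc t)
  by_cases n0 : ∀ i, ‖(x 0 : ℂ) - α j * y 0‖ ≤ ‖(x 0 : ℂ) - α i * y 0‖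
  swap
  · linarith [hfar 0 n0]
  by_cases n1 : ∀ i, ‖(x 1 : ℂ) - α j * y 1‖ ≤ ‖(x 1 : ℂ) - α i * y 1‖
  swap
  · linarith [hfar 1 n1, hlog 1]
  by_cases n2 : ∀ i, ‖(x 2 : ℂ) - α j * y 2‖ ≤ ‖(x 2 : ℂ) - α i * y 2‖
  swap
  · linarith [hfar 2 n2, hlog 2]
  have g0 := hgap 0 1 (by decide) n0
  have g1 := hgap 1 2 (by decide) n1
  have g2 := hgap 2 3 (by decide) n2
  by_cases hbig : 38 * Real.log M ≤ Real.log (y 3)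
  · have h34 : Real.log (y 3) ≤ Real.log (y 4) :=
      Real.log_le_log (by exact_mod_cast hy 3) (by exact_mod_cast hmono (by decide))
    have n3 : ∀ i, ‖(x 3 : ℂ) - α j * y 3‖ ≤ ‖(x 3 : ℂ) - α i * y 3‖ := by
      by_contra n3
      linarith [hfar 3 n3]
    have n4 : ∀ i, ‖(x 4 : ℂ) - α j * y 4‖ ≤ ‖(x 4 : ℂ) - α i * y 4‖ := by
      by_contra n4
      linarith [hfar 4 n4]
    have g3 := hgap 3 4 (by decide) n3
    linarith [h.no_large_gap hΛ (hy 3) (hy 4) (hs 3) (hs 4) n3 n4 hbig]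
  · linarith

end HasQuarticRoots

theorem exists_sorted_five {S : Type*} (κ : S → ℤ) {X : Finset S} (hX : X.card = 5) :
    ∃ s : Fin 5 → S, Function.Injective s ∧ (∀ t, s t ∈ X) ∧ Monotone (κ ∘ s) := by
  let e := (X.equivFinOfCardEq hX).symm
  let f : Fin 5 → S := fun t => e t
  have hf : Function.Injective f := Subtype.val_injective.comp e.injective
  exact ⟨f ∘ Tuple.sort (κ ∘ f), hf.comp (Tuple.sort (κ ∘ f)).injective,
    fun t => (e (Tuple.sort (κ ∘ f) t)).2, Tuple.monotone_sort (κ ∘ f)⟩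

theorem exists_last_five {S : Type*} [DecidableEq S] (κ : S → ℤ) (b : S → ℝ) (k : ℕ) :
    ∀ X : Finset S, X.card = 5 + k → (∀ s ∈ X, 0 < κ s) →
    (∀ s ∈ X, ∀ s' ∈ X, s ≠ s' → κ s ≤ κ s' → b s ≤ 1 + Real.log (κ s') - Real.log (κ s)) →
    ∃ Z ⊆ X, Z.card = 5 ∧ ∃ s : Fin 5 → S, Function.Injective s ∧ (∀ t, s t ∈ X) ∧
      Monotone (κ ∘ s) ∧ ∀ t ∈ X, (∀ x ∈ X, κ t ≤ κ x) →
        ∑ x ∈ X \ Z, (b x - 1) ≤ Real.log (κ (s 0)) - Real.log (κ t) := by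
  induction k with
  | zero =>
    intro X hX hpos _
    obtain ⟨s, hs, hsX, hmono⟩ := exists_sorted_five κ hX
    refine ⟨X, subset_rfl, hX, s, hs, hsX, hmono, fun t ht hmin => ?_⟩
    rw [Finset.sdiff_self, Finset.sum_empty, sub_nonneg]
    exact Real.log_le_log (by exact_mod_cast hpos t ht) (by exact_mod_cast hmin _ (hsX 0))
  | succ k ih =>
    intro X hX hpos hb
    obtain ⟨a, ha, hmin⟩ := X.exists_min_image κ (Finset.card_pos.mp (by omega))
    have hsub := Finset.erase_subset a X
    have hcard : (X.erase a).card = 5 + k := by rw [Finset.card_erase_of_mem ha]; omega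
    obtain ⟨Z, hZ, hZ5, s, hs, hsX, hmono, hsum⟩ := ih (X.erase a) hcard
      (fun s hs => hpos s (hsub hs)) fun s hs s' hs' => hb s (hsub hs) s' (hsub hs')
    obtain ⟨c, hc, hcmin⟩ := (X.erase a).exists_min_image κ (Finset.card_pos.mp (by omega))
    refine ⟨Z, hZ.trans hsub, hZ5, s, hs, fun t => hsub (hsX t), hmono, fun t ht htmin => ?_⟩
    have haZ : a ∉ Z := fun h => Finset.notMem_erase a X (hZ h)
    have hta : κ t = κ a := le_antisymm (htmin a ha) (hmin t ht)
    have hXZ : X \ Z = insert a (X.erase a \ Z) := by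
      rw [← Finset.insert_sdiff_of_notMem _ haZ, Finset.insert_erase ha]
    rw [hXZ, Finset.sum_insert (by simp), hta]
    have h1 := hsum c hc hcmin
    have h2 := hb a ha c (hsub hc) (Finset.ne_of_mem_erase hc).symm (hmin c (hsub hc))
    linarith

theorem exists_exceptional_set {S : Type*} [DecidableEq S] (κ : S → ℤ) (b : S → ℝ) {T X : Finset S}
    (hXT : X ⊆ T) (hpos : ∀ s ∈ T, 0 < κ s)
    (hb1 : ∀ s ∈ T, s ∉ X → b s ≤ 1)
    (hb : ∀ s ∈ X, ∀ s' ∈ X, s ≠ s' → κ s ≤ κ s' →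
      b s ≤ 1 + Real.log (κ s') - Real.log (κ s)) :
    ∃ Z ⊆ T, Z.card ≤ 5 ∧ ∃ u : ℝ, ∑ x ∈ T \ Z, b x ≤ T.card + u ∧
      (u = 0 ∨ ∃ s : Fin 5 → S, Function.Injective s ∧ (∀ t, s t ∈ X) ∧ Monotone (κ ∘ s) ∧
        u = Real.log (κ (s 0))) := by
  have hout : ∑ x ∈ T \ X, (b x - 1) ≤ 0 := Finset.sum_nonpos fun x hx => by
    rw [Finset.mem_sdiff] at hx
    linarith [hb1 x hx.1 hx.2]
  have hconv : ∀ Z ⊆ X, ∑ x ∈ T \ Z, b x ≤ T.card + ∑ x ∈ X \ Z, (b x - 1) := by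
    intro Z hZ
    have h1 : ∑ x ∈ T \ Z, (b x - 1) = ∑ x ∈ T \ X, (b x - 1) + ∑ x ∈ X \ Z, (b x - 1) := by
      rw [← Finset.sum_union (Finset.disjoint_left.mpr fun x hx hx' =>
        (Finset.mem_sdiff.mp hx).2 (Finset.mem_sdiff.mp hx').1)]
      congr 1
      ext x
      simp only [Finset.mem_sdiff, Finset.mem_union]
      have := @hXT x
      have := @hZ x
      tauto
    have h2 : ((T \ Z).card : ℝ) ≤ T.card := by
      exact_mod_cast Finset.card_le_card Finset.sdiff_subset
    rw [Finset.sum_sub_distrib] at h1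
    simp only [Finset.sum_const, nsmul_eq_mul, mul_one] at h1
    linarith
  by_cases hX : X.card ≤ 5
  · refine ⟨X, hXT, hX, 0, ?_, Or.inl rfl⟩
    have := hconv X subset_rfl
    rwa [Finset.sdiff_self, Finset.sum_empty] at this
  · obtain ⟨k, hk⟩ := Nat.exists_eq_add_of_le (Nat.le_of_not_le hX)
    obtain ⟨Z, hZ, hZ5, s, hs, hsX, hmono, hsum⟩ :=
      exists_last_five κ b k X hk (fun s hs => hpos s (hXT hs)) hb
    obtain ⟨c, hc, hcmin⟩ := X.exists_min_image κ (Finset.card_pos.mp (by omega))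
    refine ⟨Z, hZ.trans hXT, hZ5.le, Real.log (κ (s 0)), ?_, Or.inr ⟨s, hs, hsX, hmono, rfl⟩⟩
    have h1 := hconv Z hZ
    have h2 := hsum c hc hcmin
    have h3 : 0 ≤ Real.log (κ c) := Real.log_nonneg (by exact_mod_cast hpos c (hXT hc))
    linarith

theorem exists_bezout_small {x y : ℤ} (h : IsCoprime x y) (hy : 0 < y) :
    ∃ x' y' : ℤ, x * y' - x' * y = 1 ∧ 2 * |y'| ≤ y := by
  obtain ⟨a, b, hab⟩ := h
  have h1 := Int.emod_nonneg (2 * a + y) (by omega : 2 * y ≠ 0)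
  have h2 := Int.emod_lt_of_pos (2 * a + y) (by omega : 0 < 2 * y)
  have h3 := Int.emod_add_mul_ediv (2 * a + y) (2 * y)
  set c := (2 * a + y) / (2 * y)
  refine ⟨-b - c * x, a - c * y, by linear_combination hab, ?_⟩
  have h4 : 2 * (a - c * y) = (2 * a + y) % (2 * y) - y := by linear_combination -h3
  rw [← abs_two, ← abs_mul, h4, abs_le]
  constructor <;> linarith

/-- The logarithmic contribution of the root `z` to the Mahler measure of the form transformed by
a unimodular matrix with first column `(x, y)`. -/
noncomputable def logContribution (z : ℂ) (s : ℤ × ℤ) : ℝ :=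
  Real.log (max 1 (1 / (s.2 * ‖(s.1 : ℂ) - z * s.2‖) + 1 / 2))

theorem logContribution_nonneg (z : ℂ) (s : ℤ × ℤ) : 0 ≤ logContribution z s :=
  Real.log_nonneg (le_max_left _ _)

theorem log_five_halves_le_one : Real.log (5 / 2) ≤ 1 := by
  rw [Real.log_le_iff_le_exp (by norm_num)]
  linarith [Real.exp_one_gt_d9]

theorem logContribution_le_one {z : ℂ} {s : ℤ × ℤ} (h : 1 < 2 * s.2 * ‖(s.1 : ℂ) - z * s.2‖) :
    logContribution z s ≤ 1 := by
  refine (Real.log_le_log (by positivity) (max_le (by norm_num) ?_)).trans log_five_halves_le_one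
  have h1 : 1 / (s.2 * ‖(s.1 : ℂ) - z * s.2‖) ≤ 2 := by
    rw [div_le_iff₀ (by linarith)]
    linarith
  linarith

theorem logContribution_le {z : ℂ} {s s' : ℤ × ℤ} (hs : 0 < s.2) (hss : s.2 ≤ s'.2)
    (h : 1 ≤ 2 * s'.2 * ‖(s.1 : ℂ) - z * s.2‖) :
    logContribution z s ≤ 1 + Real.log s'.2 - Real.log s.2 := by
  have hy : (0 : ℝ) < s.2 := by exact_mod_cast hs
  have hyy : (s.2 : ℝ) ≤ s'.2 := by exact_mod_cast hss
  have hy' : (0 : ℝ) < s'.2 := hy.trans_le hyy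
  have hq : 1 ≤ (s'.2 : ℝ) / s.2 := (one_le_div hy).mpr hyy
  have hL : 0 < ‖(s.1 : ℂ) - z * s.2‖ := pos_of_mul_pos_right (by linarith) (by positivity : 0 ≤ 2 * (s'.2 : ℝ))
  have h1 : 1 / (s.2 * ‖(s.1 : ℂ) - z * s.2‖) ≤ 2 * (s'.2 / s.2) := by
    rw [div_le_iff₀ (by positivity)]
    have : 2 * ((s'.2 : ℝ) / s.2) * (s.2 * ‖(s.1 : ℂ) - z * s.2‖) =
        2 * s'.2 * ‖(s.1 : ℂ) - z * s.2‖ := by field_simp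
    linarith
  have h2 : logContribution z s ≤ Real.log (5 / 2 * (s'.2 / s.2)) :=
    Real.log_le_log (by positivity) (max_le (by linarith) (by linarith))
  rw [Real.log_mul (by norm_num) (by positivity), Real.log_div hy'.ne' hy.ne'] at h2
  linarith [log_five_halves_le_one]

namespace HasQuarticRoots

variable {F : ℤ[X]} {α : Fin 4 → ℂ} {M : ℝ}

theorem le_sum_logContribution (h : HasQuarticRoots F α M)
    (hred : ∀ p q r s : ℤ, p * s - r * q = 1 → IsUnitValue α p q →
      M / 2 ≤ ∏ i, max ‖(p : ℂ) - α i * q‖ ‖(r : ℂ) - α i * s‖)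
    {s : ℤ × ℤ} (hy : 0 < s.2) (hs : IsUnitValue α s.1 s.2) :
    Real.log M - 1 ≤ ∑ i, logContribution (α i) s := by
  obtain ⟨x', y', hdet, hsmall⟩ := exists_bezout_small (h.isCoprime hy hs) hy
  have hM := h.one_le_M
  have hyr : (0 : ℝ) < s.2 := by exact_mod_cast hy
  have h1 := hred s.1 s.2 x' y' hdet hs
  have h2 : ∀ i, max ‖(s.1 : ℂ) - α i * s.2‖ ‖(x' : ℂ) - α i * y'‖ ≤ ‖(s.1 : ℂ) - α i * s.2‖ *
      max 1 (1 / (s.2 * ‖(s.1 : ℂ) - α i * s.2‖) + 1 / 2) := fun i => by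
    have hL := norm_linear_pos hs i
    refine max_le (le_mul_of_one_le_right hL.le (le_max_left _ _)) ?_
    refine le_trans ?_ (mul_le_mul_of_nonneg_left (le_max_right _ _) hL.le)
    have e1 : ((s.2 : ℤ) : ℂ) * (x' - α i * y') = y' * (s.1 - α i * s.2) - 1 := by
      have : ((s.1 * y' - x' * s.2 : ℤ) : ℂ) = 1 := by rw [hdet]; simp
      push_cast at this
      linear_combination -this
    have e2 : (s.2 : ℝ) * ‖(x' : ℂ) - α i * y'‖ ≤ |(y' : ℝ)| * ‖(s.1 : ℂ) - α i * s.2‖ + 1 := by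
      calc (s.2 : ℝ) * ‖(x' : ℂ) - α i * y'‖ = ‖((s.2 : ℤ) : ℂ) * (x' - α i * y')‖ := by
            rw [norm_mul, Complex.norm_intCast, abs_of_pos hyr]
        _ ≤ _ := by
            rw [e1]
            refine (norm_sub_le _ _).trans_eq ?_
            rw [norm_mul, Complex.norm_intCast, norm_one]
    have e3 : 2 * |(y' : ℝ)| ≤ s.2 := by exact_mod_cast hsmall
    have e4 : 2 * |(y' : ℝ)| * ‖(s.1 : ℂ) - α i * s.2‖ ≤ s.2 * ‖(s.1 : ℂ) - α i * s.2‖ := by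
      gcongr
    have e5 : ‖(s.1 : ℂ) - α i * s.2‖ * (1 / (s.2 * ‖(s.1 : ℂ) - α i * s.2‖) + 1 / 2) =
        (s.2 * ‖(s.1 : ℂ) - α i * s.2‖ / 2 + 1) / s.2 := by
      field_simp
      ring
    rw [e5, le_div_iff₀ hyr]
    linarith
  have h3 : M / 2 ≤ ∏ i, max 1 (1 / (s.2 * ‖(s.1 : ℂ) - α i * s.2‖) + 1 / 2) := by
    refine (h1.trans (Finset.prod_le_prod (fun i _ => by positivity) fun i _ => h2 i)).trans_eq ?_
    rw [Finset.prod_mul_distrib, show ∏ i, ‖(s.1 : ℂ) - α i * s.2‖ = 1 from hs, one_mul]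
  have h4 := Real.log_le_log (by positivity) h3
  rw [Real.log_prod fun i _ => by positivity, Real.log_div (by positivity) (by norm_num)] at h4
  have := Real.log_two_lt_d9
  unfold logContribution
  linarith

/-- A reduced quartic form of large Mahler measure represents `±1` at most `25` times with
positive second coordinate. -/
theorem card_le (h : HasQuarticRoots F α M) (hΛ : 10 ^ 6 ≤ Real.log M)
    (hred : ∀ p q r s : ℤ, p * s - r * q = 1 → IsUnitValue α p q →
      M / 2 ≤ ∏ i, max ‖(p : ℂ) - α i * q‖ ‖(r : ℂ) - α i * s‖)
    {T : Finset (ℤ × ℤ)} (hT : ∀ s ∈ T, 0 < s.2 ∧ IsUnitValue α s.1 s.2) : T.card ≤ 25 := by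
  classical
  by_contra! hcard
  obtain ⟨T', hT', hcard'⟩ := Finset.exists_subset_card_eq (Nat.succ_le_of_lt hcard)
  replace hT : ∀ s ∈ T', 0 < s.2 ∧ IsUnitValue α s.1 s.2 := fun s hs => hT s (hT' hs)
  clear hcard hT' T
  have hex : ∀ j, ∃ Z ⊆ T', Z.card ≤ 5 ∧ ∑ s ∈ T' \ Z, logContribution (α j) s ≤
      26 + ((39 * Real.log M - 13 * Real.log (rootSeparation α j)) / 27 + 2) := by
    intro j
    obtain ⟨Z, hZ, hZ5, u, hu, hu'⟩ := exists_exceptional_set (fun s : ℤ × ℤ => s.2)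
      (logContribution (α j)) (T := T')
      (X := T'.filter fun s => 2 * s.2 * ‖(s.1 : ℂ) - α j * s.2‖ ≤ 1) (Finset.filter_subset _ _)
      (fun s hs => (hT s hs).1) (fun s hs hsX => logContribution_le_one (by
        by_contra! hle
        exact hsX (Finset.mem_filter.mpr ⟨hs, hle⟩)))
      (fun s hs s' hs' hne hle => by
        rw [Finset.mem_filter] at hs hs'
        obtain ⟨hy, hv⟩ := hT s hs.1
        obtain ⟨hy', hv'⟩ := hT s' hs'.1
        exact logContribution_le hy hle
          (one_le_of_close hy hle (h.det_ne_zero hy hy' hv hv' hne) hs'.2))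
    refine ⟨Z, hZ, hZ5, hu.trans ?_⟩
    rw [hcard']
    push_cast
    have hub : u ≤ (39 * Real.log M - 13 * Real.log (rootSeparation α j)) / 27 + 2 := by
      rcases hu' with rfl | ⟨s, hs, hsX, hmono, rfl⟩
      · linarith [h.log_rootSeparation_le j]
      · have hsX' := fun t => Finset.mem_filter.mp (hsX t)
        exact h.log_smallest_le hΛ (x := fun t => (s t).1) (y := fun t => (s t).2)
          (fun t => (hT _ (hsX' t).1).1) hmono hs (fun t => (hT _ (hsX' t).1).2)
          fun t => (hsX' t).2
    linarith
  choose Z hZ hZ5 hsum using hex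
  have hR : 6 ≤ (T' \ Finset.univ.biUnion Z).card := by
    have h1 := Finset.le_card_sdiff (Finset.univ.biUnion Z) T'
    have h2 : (Finset.univ.biUnion Z).card ≤ 4 * 5 := by
      simpa using Finset.card_biUnion_le_card_mul Finset.univ Z 5 fun j _ => hZ5 j
    omega
  have h1 : ∑ s ∈ T' \ Finset.univ.biUnion Z, (Real.log M - 1) ≤
      ∑ j, ∑ s ∈ T' \ Z j, logContribution (α j) s :=
    calc _ ≤ ∑ s ∈ T' \ Finset.univ.biUnion Z, ∑ j, logContribution (α j) s := by
          refine Finset.sum_le_sum fun s hs => ?_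
          obtain ⟨hy, hv⟩ := hT s (Finset.mem_sdiff.mp hs).1
          exact h.le_sum_logContribution hred hy hv
      _ = ∑ j, ∑ s ∈ T' \ Finset.univ.biUnion Z, logContribution (α j) s := Finset.sum_comm
      _ ≤ _ := Finset.sum_le_sum fun j _ => Finset.sum_le_sum_of_subset_of_nonneg
          (Finset.sdiff_subset_sdiff subset_rfl (Finset.subset_biUnion_of_mem Z (Finset.mem_univ j)))
          fun s _ _ => logContribution_nonneg _ _
  have h2 := h1.trans (Finset.sum_le_sum fun j _ => hsum j)
  have h3 := h.sum_log_rootSeparation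
  rw [Fin.sum_univ_four] at h2 h3
  rw [Finset.sum_const, nsmul_eq_mul] at h2
  have h4 : (6 : ℝ) * (Real.log M - 1) ≤
      (T' \ Finset.univ.biUnion Z).card * (Real.log M - 1) := by
    have : (6 : ℝ) ≤ (T' \ Finset.univ.biUnion Z).card := by exact_mod_cast hR
    exact mul_le_mul_of_nonneg_right this (by linarith)
  linarith

end HasQuarticRoots

/-- The binary quartic form with integer coefficients evaluated in an arbitrary commutative ring. -/
def binaryQuartic (a b c d e : ℤ) {R : Type*} [CommRing R] (U V : R) : R :=
  a * U ^ 4 + b * U ^ 3 * V + c * U ^ 2 * V ^ 2 + d * U * V ^ 3 + e * V ^ 4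

theorem intCast_quarticEval (a b c d e x y : ℤ) (R : Type*) [CommRing R] :
    (quarticEval a b c d e x y : R) = binaryQuartic a b c d e (x : R) (y : R) := by
  simp [quarticEval, binaryQuartic]

theorem quarticDisc_syzygy (a b c d e : ℤ) : 27 * quarticDisc a b c d e =
    4 * (12 * a * e - 3 * b * d + c ^ 2) ^ 3 -
      (72 * a * c * e + 9 * b * c * d - 27 * a * d ^ 2 - 27 * e * b ^ 2 - 2 * c ^ 3) ^ 2 := by
  unfold quarticDisc
  ring

theorem quarticDisc_neg (a b c d e : ℤ) :
    quarticDisc (-a) (-b) (-c) (-d) (-e) = quarticDisc a b c d e := by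
  unfold quarticDisc
  ring

/-- A unimodular substitution produces an integral form of the same discriminant. -/
theorem exists_transformed_form (a b c d e : ℤ) {p q r s : ℤ} (hdet : p * s - r * q = 1) :
    ∃ b' c' d' e' : ℤ,
      quarticDisc (quarticEval a b c d e p q) b' c' d' e' = quarticDisc a b c d e ∧
      ∀ (R : Type) [CommRing R] (U V : R),
        binaryQuartic a b c d e ((p : R) * U + (r : R) * V) ((q : R) * U + (s : R) * V) =
          binaryQuartic (quarticEval a b c d e p q) b' c' d' e' U V := by
  obtain ⟨a', ha'⟩ : ∃ a', a' = quarticEval a b c d e p q := ⟨_, rfl⟩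
  obtain ⟨b', hb'⟩ : ∃ b', b' = 4 * a * p ^ 3 * r + b * (3 * p ^ 2 * r * q + p ^ 3 * s)
    + c * (2 * p * r * q ^ 2 + 2 * p ^ 2 * q * s) + d * (r * q ^ 3 + 3 * p * q ^ 2 * s)
    + 4 * e * q ^ 3 * s := ⟨_, rfl⟩
  obtain ⟨c', hc'⟩ : ∃ c', c' = 6 * a * p ^ 2 * r ^ 2
    + b * (3 * p * r ^ 2 * q + 3 * p ^ 2 * r * s)
    + c * (r ^ 2 * q ^ 2 + 4 * p * r * q * s + p ^ 2 * s ^ 2)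
    + d * (3 * r * q ^ 2 * s + 3 * p * q * s ^ 2) + 6 * e * q ^ 2 * s ^ 2 := ⟨_, rfl⟩
  obtain ⟨d', hd'⟩ : ∃ d', d' = 4 * a * p * r ^ 3 + b * (r ^ 3 * q + 3 * p * r ^ 2 * s)
    + c * (2 * r ^ 2 * q * s + 2 * p * r * s ^ 2) + d * (3 * r * q * s ^ 2 + p * s ^ 3)
    + 4 * e * q * s ^ 3 := ⟨_, rfl⟩
  obtain ⟨e', he'⟩ : ∃ e', e' = quarticEval a b c d e r s := ⟨_, rfl⟩
  refine ⟨b', c', d', e', ?_, fun R _ U V => ?_⟩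
  · rw [← ha']
    unfold quarticEval at ha' he'
    have hI : 12 * a' * e' - 3 * b' * d' + c' ^ 2 =
        (p * s - r * q) ^ 4 * (12 * a * e - 3 * b * d + c ^ 2) := by
      subst ha' hb' hc' hd' he'
      ring
    have hJ : 72 * a' * c' * e' + 9 * b' * c' * d' - 27 * a' * d' ^ 2 - 27 * e' * b' ^ 2
          - 2 * c' ^ 3 = (p * s - r * q) ^ 6 *
        (72 * a * c * e + 9 * b * c * d - 27 * a * d ^ 2 - 27 * e * b ^ 2 - 2 * c ^ 3) := by
      subst ha' hb' hc' hd' he'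
      ring
    have h1 := quarticDisc_syzygy a' b' c' d' e'
    rw [hI, hJ, hdet, one_pow, one_pow, one_mul, one_mul, ← quarticDisc_syzygy] at h1
    exact mul_left_cancel₀ (by norm_num) h1
  · rw [← ha']
    unfold quarticEval at ha' he'
    subst ha' hb' hc' hd' he'
    unfold binaryQuartic
    push_cast
    ring

theorem exists_roots_fin_four {F : ℤ[X]} (hF : F.Monic) (hdeg : F.natDegree = 4) :
    ∃ α : Fin 4 → ℂ, F.map (Int.castRingHom ℂ) = ∏ i, (X - C (α i)) := by
  have hs := IsAlgClosed.splits (F.map (Int.castRingHom ℂ))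
  have hcard : (F.map (Int.castRingHom ℂ)).roots.card = 4 := by
    rw [← hs.natDegree_eq_card_roots, hF.natDegree_map, hdeg]
  obtain ⟨x, y, z, w, hroots⟩ := Multiset.card_eq_four.mp hcard
  refine ⟨![x, y, z, w], ?_⟩
  rw [hs.eq_prod_roots_of_monic (hF.map _), hroots, Fin.prod_univ_four]
  simp [mul_assoc]

/-- The monic quartic polynomial with the given lower coefficients. -/
noncomputable def monicQuartic (b c d e : ℤ) : ℤ[X] :=
  X ^ 4 + (C b * X ^ 3 + C c * X ^ 2 + C d * X + C e)

theorem degree_monicQuartic_tail (b c d e : ℤ) :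
    (C b * X ^ 3 + C c * X ^ 2 + C d * X + C e : ℤ[X]).degree < (4 : ℕ) :=
  degree_cubic_lt.trans_eq (by norm_num)

theorem monic_monicQuartic (b c d e : ℤ) : (monicQuartic b c d e).Monic :=
  monic_X_pow_add (degree_monicQuartic_tail b c d e)

theorem natDegree_monicQuartic (b c d e : ℤ) : (monicQuartic b c d e).natDegree = 4 := by
  unfold monicQuartic
  compute_degree!

theorem cubic_coeff_eq {R : Type*} [CommRing R] {b c d e b' c' d' e' : R}
    (h : C b * X ^ 3 + C c * X ^ 2 + C d * X + C e =
      C b' * X ^ 3 + C c' * X ^ 2 + C d' * X + C e') : b = b' ∧ c = c' ∧ d = d' ∧ e = e' := by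
  refine ⟨?_, ?_, ?_, ?_⟩
  · simpa [coeff_X, coeff_C, coeff_X_pow] using congrArg (fun P => P.coeff 3) h
  · simpa [coeff_X, coeff_C, coeff_X_pow] using congrArg (fun P => P.coeff 2) h
  · simpa [coeff_X, coeff_C, coeff_X_pow] using congrArg (fun P => P.coeff 1) h
  · simpa [coeff_X, coeff_C, coeff_X_pow] using congrArg (fun P => P.coeff 0) h

theorem coeff_eq_of_map_eq {b c d e : ℤ} {α : Fin 4 → ℂ}
    (h : (monicQuartic b c d e).map (Int.castRingHom ℂ) = ∏ i, (X - C (α i))) :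
    (b : ℂ) = -(α 0 + α 1 + α 2 + α 3) ∧
    (c : ℂ) = α 0 * α 1 + α 0 * α 2 + α 0 * α 3 + α 1 * α 2 + α 1 * α 3 + α 2 * α 3 ∧
    (d : ℂ) = -(α 0 * α 1 * α 2 + α 0 * α 1 * α 3 + α 0 * α 2 * α 3 + α 1 * α 2 * α 3) ∧
    (e : ℂ) = α 0 * α 1 * α 2 * α 3 := by
  have h1 : ∏ i, (X - C (α i)) = X ^ 4 + (C (-(α 0 + α 1 + α 2 + α 3)) * X ^ 3 +
      C (α 0 * α 1 + α 0 * α 2 + α 0 * α 3 + α 1 * α 2 + α 1 * α 3 + α 2 * α 3) * X ^ 2 +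
      C (-(α 0 * α 1 * α 2 + α 0 * α 1 * α 3 + α 0 * α 2 * α 3 + α 1 * α 2 * α 3)) * X +
      C (α 0 * α 1 * α 2 * α 3)) := by
    rw [Fin.prod_univ_four]
    simp only [C_add, C_mul, C_neg]
    ring
  rw [h1] at h
  simp only [monicQuartic, Polynomial.map_add, Polynomial.map_mul, Polynomial.map_pow, map_X,
    map_C] at h
  exact cubic_coeff_eq (add_left_cancel h)

theorem exists_quarticRoots_of_monic {b c d e : ℤ} (hD : quarticDisc 1 b c d e ≠ 0) :
    ∃ (F : ℤ[X]) (α : Fin 4 → ℂ), HasQuarticRoots F α (∏ i, max 1 ‖α i‖) ∧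
      ∏ j, rootSeparation α j = |(quarticDisc 1 b c d e : ℝ)| ∧
      ∀ (R : Type) [CommRing R] [Algebra ℂ R] (U V : R),
        binaryQuartic 1 b c d e U V = ∏ i, (U - algebraMap ℂ R (α i) * V) := by
  obtain ⟨α, hα⟩ := exists_roots_fin_four (monic_monicQuartic b c d e)
    (natDegree_monicQuartic b c d e)
  obtain ⟨hb, hc, hd, he⟩ := coeff_eq_of_map_eq hα
  have hsep : ∏ j, rootSeparation α j = |(quarticDisc 1 b c d e : ℝ)| := by
    have e0 : Finset.univ.erase (0 : Fin 4) = {1, 2, 3} := by decide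
    have e1 : Finset.univ.erase (1 : Fin 4) = {0, 2, 3} := by decide
    have e2 : Finset.univ.erase (2 : Fin 4) = {0, 1, 3} := by decide
    have e3 : Finset.univ.erase (3 : Fin 4) = {0, 1, 2} := by decide
    have h1 : (quarticDisc 1 b c d e : ℂ) =
        ((α 0 - α 1) * (α 0 - α 2) * (α 0 - α 3) * (α 1 - α 2) * (α 1 - α 3) * (α 2 - α 3)) ^ 2 := by
      unfold quarticDisc
      push_cast
      rw [hb, hc, hd, he]
      ring
    have h2 : |(quarticDisc 1 b c d e : ℝ)| = ‖(quarticDisc 1 b c d e : ℂ)‖ :=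
      (Complex.norm_intCast _).symm
    rw [h2, h1, Fin.prod_univ_four]
    unfold rootSeparation
    rw [e0, e1, e2, e3]
    simp only [Finset.mem_insert, Finset.mem_singleton, Fin.reduceEq, or_self, not_false_eq_true,
      Finset.prod_insert, Finset.prod_singleton, norm_pow, norm_mul]
    rw [norm_sub_rev (α 1) (α 0), norm_sub_rev (α 2) (α 0), norm_sub_rev (α 2) (α 1),
      norm_sub_rev (α 3) (α 0), norm_sub_rev (α 3) (α 1), norm_sub_rev (α 3) (α 2)]
    ring
  refine ⟨monicQuartic b c d e, α, ⟨monic_monicQuartic b c d e, hα, rfl, ?_⟩, hsep, ?_⟩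
  · change 1 ≤ ∏ j, rootSeparation α j
    rw [hsep]
    exact_mod_cast Int.one_le_abs hD
  · intro R _ _ U V
    have hcast : ∀ n : ℤ, (n : R) = algebraMap ℂ R (n : ℂ) := fun n => by simp
    unfold binaryQuartic
    rw [hcast b, hcast c, hcast d, hcast e, hb, hc, hd, he, Fin.prod_univ_four]
    simp only [map_add, map_mul, map_neg, Int.cast_one]
    ring

theorem exists_quarticRoots {a b c d e p q r s : ℤ} (hdet : p * s - r * q = 1)
    (hunit : |quarticEval a b c d e p q| = 1) (hD : quarticDisc a b c d e ≠ 0) :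
    ∃ (ε : ℤ) (F : ℤ[X]) (α : Fin 4 → ℂ), |ε| = 1 ∧
      HasQuarticRoots F α (∏ i, max 1 ‖α i‖) ∧
      ∏ j, rootSeparation α j = |(quarticDisc a b c d e : ℝ)| ∧
      ∀ (R : Type) [CommRing R] [Algebra ℂ R] (U V : R),
        binaryQuartic a b c d e ((p : R) * U + (r : R) * V) ((q : R) * U + (s : R) * V) =
          ε * ∏ i, (U - algebraMap ℂ R (α i) * V) := by
  obtain ⟨b', c', d', e', hdisc, hform⟩ := exists_transformed_form a b c d e hdet
  generalize quarticEval a b c d e p q = a' at *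
  rcases (abs_eq one_pos.le).mp hunit with rfl | rfl
  · obtain ⟨F, α, hα, hsep, hfac⟩ := exists_quarticRoots_of_monic (hdisc ▸ hD)
    refine ⟨1, F, α, abs_one, hα, by rw [hsep, hdisc], fun R _ _ U V => ?_⟩
    rw [hform, hfac, Int.cast_one, one_mul]
  · rw [← quarticDisc_neg, neg_neg] at hdisc
    obtain ⟨F, α, hα, hsep, hfac⟩ := exists_quarticRoots_of_monic (hdisc ▸ hD)
    refine ⟨-1, F, α, by norm_num, hα, by rw [hsep, hdisc], fun R _ _ U V => ?_⟩
    rw [hform, ← hfac]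
    unfold binaryQuartic
    push_cast
    ring

theorem isCoprime_of_abs_quarticEval {a b c d e x y : ℤ}
    (h : |quarticEval a b c d e x y| = 1) : IsCoprime x y := by
  have hu : quarticEval a b c d e x y * quarticEval a b c d e x y = 1 := by
    rw [← abs_mul_abs_self, h, one_mul]
  refine ⟨quarticEval a b c d e x y * (a * x ^ 3 + b * x ^ 2 * y + c * x * y ^ 2 + d * y ^ 3),
    quarticEval a b c d e x y * (e * y ^ 3), ?_⟩
  rw [← hu]
  nth_rw 4 [quarticEval]
  ring

theorem mahlerMeasure_unit_mul_prod {ε : ℤ} (hε : |ε| = 1) (P : Fin 4 → ℂ[X]) :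
    ((ε : ℂ[X]) * ∏ i, P i).mahlerMeasure = ∏ i, (P i).mahlerMeasure := by
  have h1 : ((ε : ℂ[X])).mahlerMeasure = 1 := by
    rw [← C_eq_intCast, mahlerMeasure_const, Complex.norm_intCast]
    exact_mod_cast hε
  rw [mahlerMeasure_mul, h1, one_mul, Fin.prod_univ_four, Fin.prod_univ_four, mahlerMeasure_mul,
    mahlerMeasure_mul, mahlerMeasure_mul]

/-- The Mahler measure of the form transformed by the matrix with columns `(p, q)`, `(r, s)`. -/
noncomputable def transformedMeasure (a b c d e p q r s : ℤ) : ℝ :=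
  (binaryQuartic a b c d e ((p : ℂ[X]) * X + (r : ℂ[X]) * 1)
    ((q : ℂ[X]) * X + (s : ℂ[X]) * 1)).mahlerMeasure

section Factored

variable {a b c d e p q r s ε : ℤ} {α : Fin 4 → ℂ}
  (hfac : ∀ (R : Type) [CommRing R] [Algebra ℂ R] (U V : R),
    binaryQuartic a b c d e ((p : R) * U + (r : R) * V) ((q : R) * U + (s : R) * V) =
      ε * ∏ i, (U - algebraMap ℂ R (α i) * V))

include hfac in
theorem transformedMeasure_eq (hε : |ε| = 1) :
    transformedMeasure a b c d e p q r s = ∏ i, max 1 ‖α i‖ := by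
  unfold transformedMeasure
  rw [hfac, mahlerMeasure_unit_mul_prod hε]
  refine Finset.prod_congr rfl fun i _ => ?_
  rw [mul_one, ← mahlerMeasure_X_sub_C]
  rfl

include hfac in
theorem abs_quarticEval_eq_prod (hε : |ε| = 1) (x y : ℤ) :
    (|quarticEval a b c d e (p * x + r * y) (q * x + s * y)| : ℝ) =
      ∏ i, ‖(x : ℂ) - α i * y‖ := by
  have h1 := hfac ℂ (x : ℂ) (y : ℂ)
  have h2 : ‖(ε : ℂ)‖ = 1 := by
    rw [Complex.norm_intCast]
    exact_mod_cast hε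
  rw [← Complex.norm_intCast, intCast_quarticEval]
  push_cast
  rw [h1, norm_mul, h2, one_mul, norm_prod]
  rfl

include hfac in
theorem isUnitValue_iff (hε : |ε| = 1) (x y : ℤ) : IsUnitValue α x y ↔
    |quarticEval a b c d e (p * x + r * y) (q * x + s * y)| = 1 := by
  rw [IsUnitValue, ← abs_quarticEval_eq_prod hfac hε]
  norm_cast

include hfac in
theorem transformedMeasure_mul (hε : |ε| = 1) {p' q' r' s' : ℤ} (hu : IsUnitValue α p' q') :
    transformedMeasure a b c d e (p * p' + r * q') (q * p' + s * q') (p * r' + r * s')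
      (q * r' + s * s') = ∏ i, max ‖(p' : ℂ) - α i * q'‖ ‖(r' : ℂ) - α i * s'‖ := by
  have h1 : transformedMeasure a b c d e (p * p' + r * q') (q * p' + s * q') (p * r' + r * s')
      (q * r' + s * s') = (binaryQuartic a b c d e
        ((p : ℂ[X]) * ((p' : ℂ[X]) * X + (r' : ℂ[X])) + (r : ℂ[X]) * ((q' : ℂ[X]) * X + (s' : ℂ[X])))
        ((q : ℂ[X]) * ((p' : ℂ[X]) * X + (r' : ℂ[X])) + (s : ℂ[X]) * ((q' : ℂ[X]) * X + (s' : ℂ[X])))).mahlerMeasure := by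
    unfold transformedMeasure
    congr 2 <;> push_cast <;> ring
  rw [h1, hfac, mahlerMeasure_unit_mul_prod hε]
  refine Finset.prod_congr rfl fun i _ => ?_
  have hne : (p' : ℂ) - α i * q' ≠ 0 := norm_pos_iff.mp (HasQuarticRoots.norm_linear_pos hu i)
  rw [← mahlerMeasure_C_mul_X_add_C hne]
  congr 1
  simp only [C_sub, C_mul, algebraMap_eq, ← C_eq_intCast]
  ring

end Factored

theorem Set.finite_of_card_le {S : Type*} {s : Set S} {n : ℕ}
    (h : ∀ T : Finset S, (∀ x ∈ T, x ∈ s) → T.card ≤ n) : s.Finite := by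
  by_contra hinf
  obtain ⟨T, hT, hcard⟩ := Set.Infinite.exists_subset_card_eq hinf (n + 1)
  have := h T fun x hx => hT hx
  omega

theorem HasQuarticRoots.exists_finset {F : ℤ[X]} {α : Fin 4 → ℂ} {M : ℝ}
    (h : HasQuarticRoots F α M) (hΛ : 10 ^ 6 ≤ Real.log M)
    (hred : ∀ p q r s : ℤ, p * s - r * q = 1 → IsUnitValue α p q →
      M / 2 ≤ ∏ i, max ‖(p : ℂ) - α i * q‖ ‖(r : ℂ) - α i * s‖) :
    ∃ S : Finset (ℤ × ℤ), S.card ≤ 26 ∧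
      ∀ x y : ℤ, IsUnitValue α x y → (x, y) ∈ S ∨ (-x, -y) ∈ S := by
  classical
  have hcard := fun T : Finset (ℤ × ℤ) => h.card_le hΛ hred (T := T)
  have hfin := Set.finite_of_card_le (s := {s : ℤ × ℤ | 0 < s.2 ∧ IsUnitValue α s.1 s.2}) hcard
  refine ⟨insert (1, 0) hfin.toFinset, ?_, fun x y hxy => ?_⟩
  · refine (Finset.card_insert_le _ _).trans (Nat.succ_le_succ (hcard _ fun s hs => ?_))
    simpa using hs
  · rcases lt_trichotomy y 0 with hy | rfl | hy
    · refine Or.inr (Finset.mem_insert_of_mem (hfin.mem_toFinset.mpr ⟨by simpa using hy, ?_⟩))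
      unfold IsUnitValue at hxy ⊢
      rw [← hxy]
      refine Finset.prod_congr rfl fun i _ => ?_
      rw [← norm_neg]
      congr 1
      push_cast
      ring
    · have h1 : x ^ 4 = 1 := by
        have h2 : |(x : ℝ)| ^ 4 = 1 := by simpa [IsUnitValue, Complex.norm_intCast] using hxy
        rw [(by decide : Even 4).pow_abs] at h2
        exact_mod_cast h2
      rcases (pow_eq_one_iff_of_ne_zero (by norm_num)).mp h1 with rfl | ⟨rfl, -⟩
      · exact Or.inl (Finset.mem_insert_self _ _)
      · exact Or.inr (Finset.mem_insert_self _ _)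
    · exact Or.inl (Finset.mem_insert_of_mem (hfin.mem_toFinset.mpr ⟨hy, hxy⟩))

theorem large_log_measure {F : ℤ[X]} {α : Fin 4 → ℂ} {M D : ℝ} (h : HasQuarticRoots F α M)
    (hD : 4096 * Real.exp (10 ^ 6) ^ 12 ≤ D) (hsep : ∏ j, rootSeparation α j = D) :
    10 ^ 6 ≤ Real.log M := by
  have hM := h.one_le_M
  rw [Real.le_log_iff_exp_le (by linarith)]
  have h1 : ∏ j, rootSeparation α j ≤ ∏ _j : Fin 4, (8 * M ^ 3) :=
    Finset.prod_le_prod (fun j _ => (h.rootSeparation_pos j).le) fun j _ => h.rootSeparation_le j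
  rw [hsep, Finset.prod_const, Finset.card_univ, Fintype.card_fin] at h1
  have h2 : Real.exp (10 ^ 6) ^ 12 ≤ M ^ 12 := by
    have : (8 * M ^ 3) ^ 4 = 4096 * M ^ 12 := by ring
    linarith
  exact (pow_le_pow_iff_left₀ (Real.exp_pos _).le (by linarith) (by norm_num)).mp h2

/-- Among the unimodular transforms with leading coefficient `±1` there is one of almost minimal
Mahler measure. -/
theorem exists_reduced_transform {a b c d e x₀ y₀ : ℤ} (hD : quarticDisc a b c d e ≠ 0)
    (h₀ : |quarticEval a b c d e x₀ y₀| = 1) :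
    ∃ p q r s : ℤ, p * s - r * q = 1 ∧ |quarticEval a b c d e p q| = 1 ∧
      ∀ p' q' r' s' : ℤ, p' * s' - r' * q' = 1 → |quarticEval a b c d e p' q'| = 1 →
        transformedMeasure a b c d e p q r s / 2 ≤ transformedMeasure a b c d e p' q' r' s' := by
  let V : Set ℝ := {v | ∃ p q r s : ℤ, p * s - r * q = 1 ∧ |quarticEval a b c d e p q| = 1 ∧
    v = transformedMeasure a b c d e p q r s}
  obtain ⟨u, v, huv⟩ := isCoprime_of_abs_quarticEval h₀
  have hV : V.Nonempty := ⟨_, x₀, y₀, -v, u, by linear_combination huv, h₀, rfl⟩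
  have hbdd : BddBelow V := ⟨0, by
    rintro _ ⟨p, q, r, s, -, -, rfl⟩
    exact mahlerMeasure_nonneg _⟩
  obtain ⟨_, ⟨p, q, r, s, hdet, hpq, rfl⟩, hlt⟩ := Real.lt_sInf_add_pos hV one_pos
  refine ⟨p, q, r, s, hdet, hpq, fun p' q' r' s' hdet' hpq' => ?_⟩
  have h1 : sInf V ≤ transformedMeasure a b c d e p' q' r' s' :=
    csInf_le hbdd ⟨p', q', r', s', hdet', hpq', rfl⟩
  obtain ⟨ε, F, α, hε, hα, -, hfac⟩ := exists_quarticRoots hdet' hpq' hD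
  have h2 := hα.one_le_M
  rw [← transformedMeasure_eq hfac hε] at h2
  linarith

/-- There is a constant `C > 0` such that every quartic Thue equation `|f(x,y)| = 1` with
`|Disc(f)| ≥ C` has at most 26 integer solutions, where `(x,y)` and `(-x,-y)` are counted
as the same solution. -/
theorem quartic_thue_large_disc_at_most_26_solutions :
    ∃ C : ℤ, 0 < C ∧
      ∀ a b c d e : ℤ, C ≤ |quarticDisc a b c d e| →
        ∃ S : Finset (ℤ × ℤ), S.card ≤ 26 ∧
          ∀ x y : ℤ, |quarticEval a b c d e x y| = 1 → (x, y) ∈ S ∨ (-x, -y) ∈ S := by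
  have hpos : 0 < 4096 * Real.exp (10 ^ 6) ^ 12 := by positivity
  refine ⟨⌈4096 * Real.exp (10 ^ 6) ^ 12⌉, Int.ceil_pos.mpr hpos, fun a b c d e hC => ?_⟩
  have hD : quarticDisc a b c d e ≠ 0 := by
    rw [← abs_pos]
    exact (Int.ceil_pos.mpr hpos).trans_le hC
  have hC' : 4096 * Real.exp (10 ^ 6) ^ 12 ≤ |(quarticDisc a b c d e : ℝ)| := by
    exact_mod_cast Int.ceil_le.mp hC
  by_cases hex : ∃ x y : ℤ, |quarticEval a b c d e x y| = 1
  swap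
  · exact ⟨∅, by simp, fun x y h => absurd ⟨x, y, h⟩ hex⟩
  obtain ⟨x₀, y₀, h₀⟩ := hex
  obtain ⟨p, q, r, s, hdet, hpq, hmin⟩ := exists_reduced_transform hD h₀
  obtain ⟨ε, F, α, hε, hα, hsep, hfac⟩ := exists_quarticRoots hdet hpq hD
  obtain ⟨S, hS, hmem⟩ := hα.exists_finset (large_log_measure hα hC' hsep) (by
    intro p' q' r' s' hdet' hu
    rw [← transformedMeasure_eq hfac hε, ← transformedMeasure_mul hfac hε hu]
    refine hmin _ _ _ _ ?_ ((isUnitValue_iff hfac hε p' q').mp hu)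
    linear_combination (p * s - r * q) * hdet' + hdet)
  refine ⟨S.image fun t => (p * t.1 + r * t.2, q * t.1 + s * t.2), Finset.card_image_le.trans hS,
    fun x y hxy => ?_⟩
  have ex : p * (s * x - r * y) + r * (p * y - q * x) = x := by linear_combination x * hdet
  have ey : q * (s * x - r * y) + s * (p * y - q * x) = y := by linear_combination y * hdet
  have hu : IsUnitValue α (s * x - r * y) (p * y - q * x) := by
    rwa [isUnitValue_iff hfac hε, ex, ey]
  rcases hmem _ _ hu with h | h
  · exact Or.inl (Finset.mem_image.mpr ⟨_, h, Prod.ext ex ey⟩)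
  · refine Or.inr (Finset.mem_image.mpr ⟨_, h, Prod.ext ?_ ?_⟩)
    · linear_combination -ex
    · linear_combination -ey
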